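/- Let ρ be a norm on ℝ² and U₀ a bounded open convex set whose boundary has a corner at x₀ with one-sided unit tangent vectors v⁻, v⁺ (distinct, non-collinear). If removing small triangular caps near the corner never decreases ℱ = λ + 𝒫 (as holds when U₀ minimizes ℱ), then ρ(a v⁺ + b v⁻) = a ρ(v⁺) + b ρ(v⁻) for all a, b ≥ 0. In particular, restricted to the statement about norms: if for two distinct unit vectors v⁺, v⁻ the strict triangle inequality ρ(a v⁺ + b v⁻) < aρ(v⁺) + bρ(v⁻) holds for some a, b > 0, then the perimeter decrease from truncating the corner is of order s, i.e., 𝒫(V_s) ≤ 𝒫(U₀) − cs for some c > 0 and all small s > 0, where V_s is U₀ with the corner cap of linear size s cut off by the chord joining the two boundary points at arc-length distance as and bs from x₀. -/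

import Mathlib

open Set Metric MeasureTheory Filter Pointwise Asymptotics

noncomputable section

abbrev E2 := EuclideanSpace ℝ (Fin 2)

/-- `ρ` is a norm on the plane. -/
def IsNorm (ρ : E2 → ℝ) : Prop :=
  (∀ x, ρ x = 0 ↔ x = 0) ∧ (∀ (c : ℝ) (x : E2), ρ (c • x) = |c| * ρ x) ∧
    ∀ x y, ρ (x + y) ≤ ρ x + ρ y

/-- The `ρ`-length of a curve `γ` on `[0,1]`, as the supremum over inscribed polygons. -/
def polyPerim (ρ : E2 → ℝ) (γ : ℝ → E2) : ℝ :=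
  sSup {L | ∃ n : ℕ, ∃ t : Fin (n + 1) → ℝ, StrictMono t ∧ t 0 = 0 ∧ t (Fin.last n) = 1 ∧
    L = ∑ i : Fin n, ρ (γ (t i.succ) - γ (t i.castSucc))}

/-- `γ` is a simple closed curve on `[0,1]` parametrizing the boundary of `U`. -/
def JordanParam (U : Set E2) (γ : ℝ → E2) : Prop :=
  ContinuousOn γ (Icc 0 1) ∧ γ 0 = γ 1 ∧ InjOn γ (Ico 0 1) ∧ γ '' Icc 0 1 = frontier U

/-- `U` is a Jordan domain. -/
def IsJordanDomain (U : Set E2) : Prop :=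
  IsOpen U ∧ Bornology.IsBounded U ∧ ∃ γ : ℝ → E2, JordanParam U γ

/-- The `ρ`-perimeter of a set. -/
def setPerim (ρ : E2 → ℝ) (U : Set E2) : ℝ :=
  sSup {L | ∃ γ : ℝ → E2, JordanParam U γ ∧ L = polyPerim ρ γ}

/-- The principal Dirichlet eigenvalue of the negative Laplacian on `U`. -/
def eigen (U : Set E2) : ℝ :=
  sInf {L | ∃ g : E2 → ℝ, ContDiff ℝ (⊤ : ℕ∞) g ∧ tsupport g ⊆ U ∧ (∫ x, (g x) ^ 2) = 1 ∧
    L = ∫ x, ‖gradient g x‖ ^ 2}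

/-- The functional `ℱ = λ + 𝒫`. -/
def Ffun (ρ : E2 → ℝ) (U : Set E2) : ℝ := eigen U + setPerim ρ U

/-! ### Test functions and the Rayleigh quotient -/

/-- Smooth functions with compact support contained in `U`. -/
structure TestFn (U : Set E2) (g : E2 → ℝ) : Prop where
  contDiff : ContDiff ℝ (⊤ : ℕ∞) g
  tsupport_subset : tsupport g ⊆ U
  hasCompactSupport : HasCompactSupport g

lemma gradient_mul {f g : E2 → ℝ} {x : E2} (hf : DifferentiableAt ℝ f x)
    (hg : DifferentiableAt ℝ g x) :
    gradient (fun y => f y * g y) x = f x • gradient g x + g x • gradient f x := by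
  simp only [gradient]
  rw [fderiv_fun_mul hf hg, map_add, map_smul, map_smul]

lemma gradient_eq_zero_of_notMem_tsupport {g : E2 → ℝ} {x : E2} (hx : x ∉ tsupport g) :
    gradient g x = 0 := by
  have h : g =ᶠ[nhds x] fun _ => 0 := notMem_tsupport_iff_eventuallyEq.1 hx
  rw [h.gradient_eq]
  exact gradient_fun_const x (0 : ℝ)

lemma continuous_gradient {g : E2 → ℝ} (hg : ContDiff ℝ (⊤ : ℕ∞) g) :
    Continuous (gradient g) :=
  (InnerProductSpace.toDual ℝ E2).symm.continuous.comp (hg.continuous_fderiv (by simp))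

lemma continuousOn_gradient {U : Set E2} (hU : IsOpen U) {g : E2 → ℝ}
    (hg : ContDiffOn ℝ (⊤ : ℕ∞) g U) : ContinuousOn (gradient g) U :=
  (InnerProductSpace.toDual ℝ E2).symm.continuous.comp_continuousOn
    (hg.continuousOn_fderiv_of_isOpen hU (by simp))

namespace TestFn

variable {U : Set E2} {g : E2 → ℝ}

lemma eq_zero (hg : TestFn U g) {x : E2} (hx : x ∉ U) : g x = 0 :=
  image_eq_zero_of_notMem_tsupport fun h => hx (hg.tsupport_subset h)

lemma gradient_eq_zero (hg : TestFn U g) {x : E2} (hx : x ∉ U) : gradient g x = 0 :=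
  gradient_eq_zero_of_notMem_tsupport fun h => hx (hg.tsupport_subset h)

lemma continuous (hg : TestFn U g) : Continuous g := hg.contDiff.continuous

lemma differentiableAt (hg : TestFn U g) (x : E2) : DifferentiableAt ℝ g x :=
  (hg.contDiff.differentiable (by simp)) x

lemma mul_left (hU : IsOpen U) (hg : TestFn U g) {η : E2 → ℝ}
    (hη : ContDiffOn ℝ (⊤ : ℕ∞) η U) : TestFn U (fun x => η x * g x) := by
  have hsub : tsupport (fun x => η x * g x) ⊆ tsupport g := tsupport_mul_subset_right
  refine ⟨?_, hsub.trans hg.tsupport_subset, hg.hasCompactSupport.mono' ?_⟩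
  · rw [contDiff_iff_contDiffAt]
    intro x
    by_cases hx : x ∈ tsupport g
    · exact (hη.contDiffAt (hU.mem_nhds (hg.tsupport_subset hx))).mul hg.contDiff.contDiffAt
    · have h : (fun x => η x * g x) =ᶠ[nhds x] fun _ => 0 :=
        notMem_tsupport_iff_eventuallyEq.1 fun h => hx (hsub h)
      exact contDiffAt_const.congr_of_eventuallyEq h
  · exact (subset_tsupport _).trans hsub

/-- A function continuous on `U` times a function supported where `g` is, is integrable. -/
lemma integrable_of_continuousOn (hU : IsOpen U) (hg : TestFn U g) {F : E2 → ℝ}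
    (hF : ContinuousOn F U) (hF0 : ∀ x ∉ tsupport g, F x = 0) : Integrable F := by
  have hs : Function.support F ⊆ tsupport g := fun x hx => by
    by_contra h
    exact hx (hF0 x h)
  have hts : tsupport F ⊆ tsupport g := closure_minimal hs (isClosed_tsupport g)
  refine Continuous.integrable_of_hasCompactSupport ?_ (hg.hasCompactSupport.mono' hs)
  exact continuous_of_tsupport fun x hx =>
    hF.continuousAt (hU.mem_nhds (hg.tsupport_subset (hts hx)))

lemma integrable_sq (hg : TestFn U g) : Integrable fun x => g x ^ 2 := by
  refine (hg.continuous.pow 2).integrable_of_hasCompactSupport ?_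
  refine hg.hasCompactSupport.mono' fun x hx => ?_
  by_contra h
  exact hx (by simp [image_eq_zero_of_notMem_tsupport h])

lemma integrable_gradient_sq (hg : TestFn U g) : Integrable fun x => ‖gradient g x‖ ^ 2 := by
  refine ((continuous_gradient hg.contDiff).norm.pow 2).integrable_of_hasCompactSupport ?_
  refine hg.hasCompactSupport.mono' fun x hx => ?_
  by_contra h
  exact hx (by simp [gradient_eq_zero_of_notMem_tsupport h])

end TestFn

lemma eigen_nonneg (U : Set E2) : 0 ≤ eigen U := by
  refine Real.sInf_nonneg ?_
  rintro L ⟨g, -, -, -, rfl⟩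
  exact integral_nonneg fun x => by positivity

lemma eigen_le_of_integral_sq_eq_one {U : Set E2} {g : E2 → ℝ} (hg : TestFn U g)
    (h1 : (∫ x, g x ^ 2) = 1) : eigen U ≤ ∫ x, ‖gradient g x‖ ^ 2 := by
  refine csInf_le ⟨0, ?_⟩ ⟨g, hg.contDiff, hg.tsupport_subset, h1, rfl⟩
  rintro L ⟨g, -, -, -, rfl⟩
  exact integral_nonneg fun x => by positivity

/-- The Rayleigh quotient bound. -/
lemma eigen_mul_integral_sq_le {U : Set E2} (hU : IsOpen U) {g : E2 → ℝ} (hg : TestFn U g) :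
    eigen U * (∫ x, g x ^ 2) ≤ ∫ x, ‖gradient g x‖ ^ 2 := by
  have hN : 0 ≤ ∫ x, g x ^ 2 := integral_nonneg fun x => by positivity
  rcases hN.eq_or_lt with h0 | hpos
  · rw [← h0, mul_zero]
    exact integral_nonneg fun x => by positivity
  set N := ∫ x, g x ^ 2
  have hc : ((√N)⁻¹) ^ 2 = N⁻¹ := by rw [inv_pow, Real.sq_sqrt hN]
  have hu := hg.mul_left hU (η := fun _ => (√N)⁻¹) contDiffOn_const
  have h := eigen_le_of_integral_sq_eq_one hu (by
    simp only [mul_pow, hc]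
    rw [integral_const_mul]
    exact inv_mul_cancel₀ hpos.ne')
  have hgr : ∀ x, ‖gradient (fun x => (√N)⁻¹ * g x) x‖ ^ 2 = N⁻¹ * ‖gradient g x‖ ^ 2 := by
    intro x
    rw [gradient_mul (differentiableAt_const _) (hg.differentiableAt x), gradient_fun_const,
      smul_zero, add_zero, norm_smul, mul_pow, Real.norm_eq_abs, sq_abs, hc]
  simp only [hgr] at h
  rw [integral_const_mul, inv_mul_eq_div, le_div_iff₀ hpos] at h
  exact h

lemma exists_testFn_near_eigen {U : Set E2} (hU : IsOpen U) (hUb : Bornology.IsBounded U)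
    (hne : U.Nonempty) {δ : ℝ} (hδ : 0 < δ) :
    ∃ g, TestFn U g ∧ (∫ x, g x ^ 2) = 1 ∧ (∫ x, ‖gradient g x‖ ^ 2) ≤ eigen U + δ := by
  have hne' : {L | ∃ g : E2 → ℝ, ContDiff ℝ (⊤ : ℕ∞) g ∧ tsupport g ⊆ U ∧
      (∫ x, (g x) ^ 2) = 1 ∧ L = ∫ x, ‖gradient g x‖ ^ 2}.Nonempty := by
    obtain ⟨o, ho⟩ := hne
    obtain ⟨r, hr, hrU⟩ := Metric.isOpen_iff.1 hU o ho
    let f : ContDiffBump o := ⟨r / 4, r / 2, by positivity, by linarith⟩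
    have hf : TestFn U f := ⟨f.contDiff, by
      rw [f.tsupport_eq]
      exact (closedBall_subset_ball (by change r / 2 < r; linarith)).trans hrU,
      f.hasCompactSupport⟩
    have hpos : 0 < ∫ x, f x ^ 2 := by
      refine (integral_pos_iff_support_of_nonneg (fun x => by positivity) hf.integrable_sq).2 ?_
      refine (measure_ball_pos volume o (show 0 < r / 2 by positivity)).trans_le
        (measure_mono fun x hx => ?_)
      have : x ∈ Function.support f := by rw [f.support_eq]; exact hx
      simpa using this
    set N := ∫ x, f x ^ 2
    have hc : ((√N)⁻¹) ^ 2 = N⁻¹ := by rw [inv_pow, Real.sq_sqrt hpos.le]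
    have hu := hf.mul_left hU (η := fun _ => (√N)⁻¹) contDiffOn_const
    refine ⟨_, _, hu.contDiff, hu.tsupport_subset, ?_, rfl⟩
    simp only [mul_pow, hc]
    rw [integral_const_mul]
    exact inv_mul_cancel₀ hpos.ne'
  obtain ⟨L, ⟨g, hg, hgs, hg1, rfl⟩, hL⟩ := exists_lt_of_csInf_lt hne'
    (show eigen U < eigen U + δ by linarith)
  refine ⟨g, ⟨hg, hgs, ?_⟩, hg1, hL.le⟩
  exact (hUb.subset hgs).isCompact_closure.of_isClosed_subset (isClosed_tsupport g)
    subset_closure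

/-- Testing the near-minimality of `g` with `η² g` controls the energy of `η g`. -/
lemma energy_mul_le {U : Set E2} (hU : IsOpen U) {η : E2 → ℝ}
    (hη : ContDiffOn ℝ (⊤ : ℕ∞) η U) {M : ℝ} (hM : ∀ x ∈ U, |η x| ≤ M)
    (hM' : ∀ x ∈ U, ‖gradient η x‖ ≤ M) {ε : ℝ} (hε : 0 < ε) :
    ∃ δ > 0, ∀ g, TestFn U g → (∫ x, g x ^ 2) = 1 →
      (∫ x, ‖gradient g x‖ ^ 2) ≤ eigen U + δ →
      (∫ x, ‖gradient (fun x => η x * g x) x‖ ^ 2) ≤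
        eigen U * (∫ x, (η x * g x) ^ 2) + (∫ x, ‖gradient η x‖ ^ 2 * g x ^ 2) + ε := by
  set lam := eigen U with hlam
  have hlam0 : 0 ≤ lam := eigen_nonneg U
  set B : ℝ := 2 * M ^ 4 * (lam + 1) + 8 * M ^ 4 + 1 with hB
  have hB0 : 0 < B := by positivity
  set τ : ℝ := ε / B with hτ
  have hτ0 : 0 < τ := by positivity
  refine ⟨min 1 (ε * τ), by positivity, fun g hg hg1 hgD => ?_⟩
  have hgD1 : (∫ x, ‖gradient g x‖ ^ 2) ≤ lam + 1 :=
    hgD.trans (by gcongr; exact min_le_left _ _)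
  have hgD2 : (∫ x, ‖gradient g x‖ ^ 2) ≤ lam + ε * τ :=
    hgD.trans (by gcongr; exact min_le_right _ _)
  have hηd : ∀ x ∈ U, DifferentiableAt ℝ η x := fun x hx =>
    (hη.contDiffAt (hU.mem_nhds hx)).differentiableAt (by simp)
  have hu := hg.mul_left hU hη
  have hη2 : ContDiffOn ℝ (⊤ : ℕ∞) (fun x => 1 - τ * (η x * η x)) U :=
    contDiffOn_const.sub (contDiffOn_const.mul (hη.mul hη))
  have hw := hg.mul_left hU hη2
  have hgη : Integrable fun x => ‖gradient η x‖ ^ 2 * g x ^ 2 :=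
    hg.integrable_of_continuousOn hU
      (((continuousOn_gradient hU hη).norm.pow 2).mul (hg.continuous.continuousOn.pow 2))
      fun x hx => by simp [image_eq_zero_of_notMem_tsupport hx]
  have hgw : ∀ x ∈ U, gradient (fun x => (1 - τ * (η x * η x)) * g x) x =
      (1 - τ * (η x * η x)) • gradient g x - (2 * τ * η x * g x) • gradient η x := by
    intro x hx
    have hd := hηd x hx
    have h2 : gradient (fun x => 1 - τ * (η x * η x)) x = -(2 * τ * η x) • gradient η x := by
      have e : (fun x => 1 - τ * (η x * η x)) = fun x => 1 - (τ * η x) * η x := by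
        ext; ring
      simp only [gradient]
      rw [e, fderiv_const_sub, fderiv_fun_mul (hd.const_mul τ) hd, fderiv_const_mul hd]
      simp only [map_neg, map_add, map_smul]
      module
    have hd2 : DifferentiableAt ℝ (fun x => 1 - τ * (η x * η x)) x :=
      (differentiableAt_const _).sub ((hd.mul hd).const_mul τ)
    rw [gradient_mul hd2 (hg.differentiableAt x), h2]
    module
  have hpt : ∀ x, ‖gradient (fun x => (1 - τ * (η x * η x)) * g x) x‖ ^ 2
      - lam * ((1 - τ * (η x * η x)) * g x) ^ 2 ≤
      ‖gradient g x‖ ^ 2 - lam * g x ^ 2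
      - 2 * τ * (‖gradient (fun x => η x * g x) x‖ ^ 2 - lam * (η x * g x) ^ 2
        - ‖gradient η x‖ ^ 2 * g x ^ 2)
      + τ ^ 2 * (2 * M ^ 4 * ‖gradient g x‖ ^ 2 + 8 * M ^ 4 * g x ^ 2) := by
    intro x
    by_cases hx : x ∈ U
    · rw [hgw x hx, gradient_mul (hηd x hx) (hg.differentiableAt x)]
      set p := gradient g x
      set v := gradient η x
      set h := η x
      set k := g x
      have hh : h ^ 2 ≤ M ^ 2 := sq_le_sq' (by linarith [neg_abs_le h, hM x hx])
        ((le_abs_self _).trans (hM x hx))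
      have hv : ‖v‖ ^ 2 ≤ M ^ 2 := by gcongr; exact hM' x hx
      have e1 : ‖(1 - τ * (h * h)) • p - (2 * τ * h * k) • v‖ ^ 2 =
          ‖p‖ ^ 2 - 2 * τ * (‖h • p + k • v‖ ^ 2 - ‖v‖ ^ 2 * k ^ 2)
            + τ ^ 2 * ‖(h * h) • p + (2 * h * k) • v‖ ^ 2 := by
        rw [norm_sub_sq_real, norm_add_sq_real, norm_add_sq_real]
        simp only [norm_smul, mul_pow, inner_smul_left, inner_smul_right, Real.norm_eq_abs, sq_abs,
          RCLike.conj_to_real]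
        ring
      have e2 : ‖(h * h) • p + (2 * h * k) • v‖ ^ 2 ≤
          2 * M ^ 4 * ‖p‖ ^ 2 + 8 * M ^ 4 * k ^ 2 := by
        have t1 : ‖(h * h) • p + (2 * h * k) • v‖ ^ 2 ≤
            2 * (‖(h * h) • p‖ ^ 2 + ‖(2 * h * k) • v‖ ^ 2) := by
          have := parallelogram_law_with_norm ℝ ((h * h) • p) ((2 * h * k) • v)
          nlinarith [sq_nonneg ‖(h * h) • p - (2 * h * k) • v‖]
        have t2 : ‖(h * h) • p‖ ^ 2 = h ^ 2 * h ^ 2 * ‖p‖ ^ 2 := by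
          rw [norm_smul, mul_pow, Real.norm_eq_abs, sq_abs]; ring
        have t3 : ‖(2 * h * k) • v‖ ^ 2 = 4 * (h ^ 2 * ‖v‖ ^ 2) * k ^ 2 := by
          rw [norm_smul, mul_pow, Real.norm_eq_abs, sq_abs]; ring
        have t4 : h ^ 2 * h ^ 2 ≤ M ^ 2 * M ^ 2 := by gcongr
        have t5 : h ^ 2 * ‖v‖ ^ 2 ≤ M ^ 2 * M ^ 2 := by gcongr
        rw [t2, t3] at t1
        have t6 := mul_le_mul_of_nonneg_right t4 (sq_nonneg ‖p‖)
        have t7 := mul_le_mul_of_nonneg_right t5 (sq_nonneg k)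
        nlinarith
      have e3 := mul_le_mul_of_nonneg_left e2 (sq_nonneg τ)
      have e4 : 0 ≤ lam * (τ * (h * h) * k) ^ 2 := by positivity
      rw [e1]
      nlinarith
    · rw [hw.gradient_eq_zero hx, hu.gradient_eq_zero hx, hg.gradient_eq_zero hx, hg.eq_zero hx]
      simp
  have hR := eigen_mul_integral_sq_le hU hw
  rw [← hlam] at hR
  have j1 := hg.integrable_gradient_sq.const_mul (1 + 2 * M ^ 4 * τ ^ 2)
  have j2 := hg.integrable_sq.const_mul (8 * M ^ 4 * τ ^ 2 - lam)
  have j3 := hu.integrable_gradient_sq.const_mul (-2 * τ)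
  have j4 := hu.integrable_sq.const_mul (2 * τ * lam)
  have j5 := hgη.const_mul (2 * τ)
  have j12 := j1.fun_add j2
  have j13 := j12.fun_add j3
  have j14 := j13.fun_add j4
  have hint := integral_mono
    (hw.integrable_gradient_sq.fun_add (hw.integrable_sq.const_mul (-lam)))
    (j14.fun_add j5) fun x => by linarith [hpt x]
  rw [integral_add hw.integrable_gradient_sq (hw.integrable_sq.const_mul (-lam)),
    integral_add j14 j5, integral_add j13 j4, integral_add j12 j3, integral_add j1 j2] at hint
  simp only [integral_const_mul] at hint
  rw [hg1] at hint
  have hM4 : 2 * M ^ 4 * (∫ x, ‖gradient g x‖ ^ 2) + 8 * M ^ 4 * 1 ≤ B := by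
    have := mul_le_mul_of_nonneg_left hgD1 (show 0 ≤ 2 * M ^ 4 by positivity)
    rw [hB]; linarith
  have h3 := mul_le_mul_of_nonneg_left hM4 (sq_nonneg τ)
  have hτB : τ ^ 2 * B = ε * τ := by
    rw [hτ]; field_simp
  rw [hτB] at h3
  have key : 2 * τ * ((∫ x, ‖gradient (fun x => η x * g x) x‖ ^ 2)
      - lam * (∫ x, (η x * g x) ^ 2) - ∫ x, ‖gradient η x‖ ^ 2 * g x ^ 2) ≤ 2 * τ * ε := by
    linarith
  have := le_of_mul_le_mul_left key (by positivity)
  linarith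

lemma gradient_apply (u : E2 → ℝ) (x : E2) (i : Fin 2) :
    gradient u x i = fderiv ℝ u x (EuclideanSpace.single i 1) := by
  rw [← inner_gradient_left, EuclideanSpace.inner_single_right]
  simp

lemma norm_gradient_sq (u : E2 → ℝ) (x : E2) :
    ‖gradient u x‖ ^ 2 = gradient u x 0 ^ 2 + gradient u x 1 ^ 2 := by
  rw [EuclideanSpace.norm_sq_eq, Fin.sum_univ_two, Real.norm_eq_abs, Real.norm_eq_abs, sq_abs,
    sq_abs]

lemma TestFn.continuous_gradient_apply {U : Set E2} {u : E2 → ℝ} (hu : TestFn U u) (i : Fin 2) :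
    Continuous fun x => gradient u x i :=
  (EuclideanSpace.proj i).continuous.comp (continuous_gradient hu.contDiff)

lemma integral_mul_gradient {U : Set E2} (hU : IsOpen U) {u v : E2 → ℝ} (hu : TestFn U u)
    (hv : TestFn U v) (i : Fin 2) :
    ∫ x, v x * gradient u x i = -∫ x, u x * gradient v x i := by
  have h0 : ∀ {w : E2 → ℝ} {x : E2}, x ∉ tsupport w → gradient w x i = 0 := fun h => by
    simp [gradient_eq_zero_of_notMem_tsupport h]
  have h := integral_mul_fderiv_eq_neg_fderiv_mul_of_integrable (μ := (volume : Measure E2))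
    (f := v) (g := u) (v := EuclideanSpace.single i 1) ?_ ?_ ?_
    (fun x _ => hv.differentiableAt x) (fun x _ => hu.differentiableAt x)
  · simp only [← gradient_apply] at h
    rw [h]
    simp only [mul_comm]
  · simp only [← gradient_apply]
    exact hu.integrable_of_continuousOn hU
      ((hv.continuous_gradient_apply i).mul hu.continuous).continuousOn
      fun x hx => by simp [image_eq_zero_of_notMem_tsupport hx]
  · simp only [← gradient_apply]
    exact hu.integrable_of_continuousOn hU
      (hv.continuous.mul (hu.continuous_gradient_apply i)).continuousOn
      fun x hx => by rw [h0 hx, mul_zero]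
  · exact hu.integrable_of_continuousOn hU
      (hv.continuous.mul hu.continuous).continuousOn
      fun x hx => by simp [image_eq_zero_of_notMem_tsupport hx]

/-- Hardy's inequality in a half-plane, with respect to a boundary point. -/
lemma hardy_halfPlane {U : Set E2} (hU : IsOpen U) {u : E2 → ℝ} (hu : TestFn U u) {n z : E2}
    (hn : ‖n‖ = 1) (hpos : ∀ x ∈ U, 0 < inner ℝ n (x - z)) :
    ∫ x, (‖x - z‖ ^ 2)⁻¹ * u x ^ 2 ≤ ∫ x, ‖gradient u x‖ ^ 2 := by
  have hl : ContDiff ℝ (⊤ : ℕ∞) fun x : E2 => (inner ℝ n (x - z) : ℝ) :=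
    contDiff_const.inner ℝ (contDiff_id.sub contDiff_const)
  have hq : ContDiff ℝ (⊤ : ℕ∞) fun x : E2 => ‖x - z‖ ^ 2 :=
    (contDiff_id.sub contDiff_const).norm_sq ℝ
  have hq0 : ∀ x ∈ U, 0 < ‖x - z‖ ^ 2 := fun x hx => by
    have : x - z ≠ 0 := fun h => by simpa [h] using hpos x hx
    positivity
  let F : Fin 2 → E2 → ℝ := fun i x =>
    n i * (inner ℝ n (x - z))⁻¹ - (x - z) i * (‖x - z‖ ^ 2)⁻¹
  have hFs : ∀ i, ContDiffOn ℝ (⊤ : ℕ∞) (F i) U := fun i =>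
    (contDiffOn_const.mul (hl.contDiffOn.inv fun x hx => (hpos x hx).ne')).sub
      ((((EuclideanSpace.proj (𝕜 := ℝ) i).contDiff.comp
        (contDiff_id.sub contDiff_const)).contDiffOn).mul
        (hq.contDiffOn.inv fun x hx => (hq0 x hx).ne'))
  have hFd : ∀ i, ∀ x ∈ U, gradient (F i) x i =
      -(n i ^ 2 * (inner ℝ n (x - z) ^ 2)⁻¹) - (‖x - z‖ ^ 2)⁻¹
        + 2 * (x - z) i ^ 2 * ((‖x - z‖ ^ 2) ^ 2)⁻¹ := by
    intro i x hx
    have hd : DifferentiableAt ℝ (F i) x :=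
      ((hFs i).contDiffAt (hU.mem_nhds hx)).differentiableAt (by simp)
    rw [gradient_apply, ← hd.lineDeriv_eq_fderiv]
    refine HasLineDerivAt.lineDeriv ?_
    have e1 : ∀ t : ℝ, (inner ℝ n (x + t • EuclideanSpace.single i (1 : ℝ) - z) : ℝ) =
        inner ℝ n (x - z) + t * n i := by
      intro t
      rw [add_sub_right_comm, inner_add_right, inner_smul_right, EuclideanSpace.inner_single_right]
      simp
    have e2 : ∀ t : ℝ, ‖x + t • EuclideanSpace.single i (1 : ℝ) - z‖ ^ 2 =
        ‖x - z‖ ^ 2 + 2 * t * (x - z) i + t ^ 2 := by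
      intro t
      rw [add_sub_right_comm, norm_add_sq_real, inner_smul_right,
        EuclideanSpace.inner_single_right, norm_smul]
      simp
      ring
    have e3 : ∀ t : ℝ, (x + t • EuclideanSpace.single i (1 : ℝ) - z) i = (x - z) i + t := by
      intro t
      rw [add_sub_right_comm]
      simp
    have hlx := (hpos x hx).ne'
    have hqx := (hq0 x hx).ne'
    unfold HasLineDerivAt
    simp only [F, e1, e2, e3]
    set L : ℝ := inner ℝ n (x - z)
    set q : ℝ := ‖x - z‖ ^ 2
    set y : ℝ := (x - z) i
    have d1 : HasDerivAt (fun t : ℝ => L + t * n i) (n i) 0 := by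
      simpa using ((hasDerivAt_id (0 : ℝ)).mul_const (n i)).const_add L
    have d2 : HasDerivAt (fun t : ℝ => q + 2 * t * y + t ^ 2) (2 * y) 0 := by
      have h1 := (((hasDerivAt_id (0 : ℝ)).const_mul 2).mul_const y).const_add q
      have h2 := h1.add ((hasDerivAt_id (0 : ℝ)).pow 2)
      exact h2.congr_deriv (by simp)
    have d3 : HasDerivAt (fun t : ℝ => y + t) 1 0 := by
      simpa using (hasDerivAt_id (0 : ℝ)).const_add y
    have d := ((d1.fun_inv (by simpa using hlx)).const_mul (n i)).sub
      (d3.mul (d2.fun_inv (by simpa using hqx)))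
    refine d.congr_deriv ?_
    simp only [zero_mul, mul_zero, add_zero, ne_eq, OfNat.ofNat_ne_zero, not_false_eq_true, zero_pow]
    field_simp
    ring
  let G : Fin 2 → E2 → ℝ := fun i x => F i x * u x
  have hG : ∀ i, TestFn U (G i) := fun i => hu.mul_left hU (hFs i)
  have hGt : ∀ i x, x ∉ tsupport u → G i x = 0 := fun i x hx => by
    simp [G, image_eq_zero_of_notMem_tsupport hx]
  have h0 : ∀ i x, x ∉ tsupport u → gradient u x i = 0 := fun i x hx => by
    simp [gradient_eq_zero_of_notMem_tsupport hx]
  have k1 : ∀ i, Integrable fun x => (gradient u x i - G i x) ^ 2 := fun i =>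
    hu.integrable_of_continuousOn hU
      (((hu.continuous_gradient_apply i).sub (hG i).continuous).pow 2).continuousOn
      fun x hx => by simp [h0 i x hx, hGt i x hx]
  have k2 : ∀ i, Integrable fun x => G i x * gradient u x i := fun i =>
    hu.integrable_of_continuousOn hU
      ((hG i).continuous.mul (hu.continuous_gradient_apply i)).continuousOn
      fun x hx => by simp [hGt i x hx]
  have k3 : ∀ i, Integrable fun x => u x * gradient (G i) x i := fun i =>
    hu.integrable_of_continuousOn hU
      (hu.continuous.mul ((hG i).continuous_gradient_apply i)).continuousOn
      fun x hx => by simp [image_eq_zero_of_notMem_tsupport hx]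
  have k4 : Integrable fun x => (‖x - z‖ ^ 2)⁻¹ * u x ^ 2 :=
    hu.integrable_of_continuousOn hU
      ((hq.continuous.continuousOn.inv₀ fun x hx => (hq0 x hx).ne').mul
        (hu.continuous.continuousOn.pow 2))
      fun x hx => by simp [image_eq_zero_of_notMem_tsupport hx]
  have hint : ∀ i, 0 ≤ ∫ x, ((gradient u x i - G i x) ^ 2 + G i x * gradient u x i)
      + u x * gradient (G i) x i := by
    intro i
    rw [integral_add ((k1 i).fun_add (k2 i)) (k3 i), integral_add (k1 i) (k2 i),
      integral_mul_gradient hU hu (hG i) i]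
    have : 0 ≤ ∫ x, (gradient u x i - G i x) ^ 2 := integral_nonneg fun x => by positivity
    linarith
  have hpt : ∀ x, ((((gradient u x 0 - G 0 x) ^ 2 + G 0 x * gradient u x 0)
      + u x * gradient (G 0) x 0) +
      (((gradient u x 1 - G 1 x) ^ 2 + G 1 x * gradient u x 1) + u x * gradient (G 1) x 1))
      + (‖x - z‖ ^ 2)⁻¹ * u x ^ 2 = ‖gradient u x‖ ^ 2 := by
    intro x
    by_cases hx : x ∈ U
    · have hgr : ∀ i, gradient (G i) x i = F i x * gradient u x i + u x * gradient (F i) x i := by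
        intro i
        rw [gradient_mul (((hFs i).contDiffAt (hU.mem_nhds hx)).differentiableAt (by simp))
          (hu.differentiableAt x)]
        simp
      rw [norm_gradient_sq, hgr 0, hgr 1, hFd 0 x hx, hFd 1 x hx]
      have hlx := (hpos x hx).ne'
      have hqx := (hq0 x hx).ne'
      have hn2 : n 0 ^ 2 + n 1 ^ 2 = 1 := by
        have := EuclideanSpace.norm_sq_eq n
        rw [hn, Fin.sum_univ_two] at this
        simpa using this.symm
      have hL : (inner ℝ n (x - z) : ℝ) = n 0 * (x - z) 0 + n 1 * (x - z) 1 := by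
        simp [PiLp.inner_apply, Fin.sum_univ_two, mul_comm]
      have hQ : ‖x - z‖ ^ 2 = (x - z) 0 ^ 2 + (x - z) 1 ^ 2 := by
        rw [EuclideanSpace.norm_sq_eq, Fin.sum_univ_two]; simp
      simp only [G, F]
      generalize (inner ℝ n (x - z) : ℝ) = L at *
      generalize ‖x - z‖ ^ 2 = q at *
      generalize (x - z) 0 = y0 at *
      generalize (x - z) 1 = y1 at *
      generalize gradient u x 0 = a at *
      generalize gradient u x 1 = b at *
      generalize u x = w at *
      generalize n 0 = n0 at *
      generalize n 1 = n1 at *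
      have a1 : L * L⁻¹ = 1 := mul_inv_cancel₀ hlx
      have a2 : q * q⁻¹ = 1 := mul_inv_cancel₀ hqx
      simp only [← inv_pow]
      generalize L⁻¹ = l at *
      generalize q⁻¹ = p at *
      have b1 : (y0 ^ 2 + y1 ^ 2) * p = 1 := by rw [← hQ]; exact a2
      have b2 : (n0 * y0 + n1 * y1) * l = 1 := by rw [← hL]; exact a1
      linear_combination (3 * w ^ 2 * p) * b1 - 2 * w ^ 2 * p * b2
    · rw [hu.gradient_eq_zero hx]
      simp [hu.eq_zero hx, G]
  rw [← integral_congr_ae (ae_of_all _ hpt)]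
  have m : ∀ i, Integrable fun x => ((gradient u x i - G i x) ^ 2 + G i x * gradient u x i)
      + u x * gradient (G i) x i := fun i => ((k1 i).fun_add (k2 i)).fun_add (k3 i)
  rw [integral_add ((m 0).fun_add (m 1)) k4, integral_add (m 0) (m 1)]
  linarith [hint 0, hint 1]

lemma hasGradientAt_norm_sub_sq_rpow {z x : E2} (hx : x ≠ z) (p : ℝ) :
    HasGradientAt (fun y : E2 => (‖y - z‖ ^ 2) ^ p)
      ((2 * p * (‖x - z‖ ^ 2) ^ p * (‖x - z‖ ^ 2)⁻¹) • (x - z)) x := by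
  have hq : ‖x - z‖ ^ 2 ≠ 0 := by
    have : x - z ≠ 0 := sub_ne_zero.2 hx
    positivity
  have h1 : HasFDerivAt (fun y : E2 => ‖y - z‖ ^ 2) (2 • (innerSL ℝ (x - z))) x := by
    have := ((hasFDerivAt_id (𝕜 := ℝ) x).sub_const z).norm_sq
    simpa using this
  have h2 := h1.rpow_const (p := p) (Or.inl hq)
  rw [hasGradientAt_iff_hasFDerivAt]
  refine h2.congr_fderiv ?_
  ext y
  rw [Real.rpow_sub_one hq]
  simp
  ring

/-- A weighted `L²` bound for near-minimizers, independent of the distance from the pole `z`. -/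
lemma integral_weight_le {U : Set E2} (hU : IsOpen U) :
    ∃ M > 0, ∀ (n z : E2) (r : ℝ), 0 < r → ‖n‖ = 1 → (∀ x ∈ U, r ≤ inner ℝ n (x - z)) →
      ∃ δ > 0, ∀ g, TestFn U g → (∫ x, g x ^ 2) = 1 →
        (∫ x, ‖gradient g x‖ ^ 2) ≤ eigen U + δ →
        ∫ x, (‖x - z‖ ^ 2)⁻¹ * ((‖x - z‖ ^ 2) ^ (-(3 / 8) : ℝ) * g x) ^ 2 ≤ M := by
  set lam := eigen U with hlam
  have hlam0 : 0 ≤ lam := eigen_nonneg U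
  set C : ℝ := lam * ((3 / (16 * (lam + 1))) ^ (-(3 / 8) : ℝ)) ^ 2 with hC
  have hC0 : 0 ≤ C := by positivity
  refine ⟨4 * (C + 1), by positivity, fun n z r hr hn hU' => ?_⟩
  have hpos : ∀ x ∈ U, 0 < (inner ℝ n (x - z) : ℝ) := fun x hx => hr.trans_le (hU' x hx)
  have hdist : ∀ x ∈ U, r ≤ ‖x - z‖ := fun x hx => by
    have := real_inner_le_norm n (x - z)
    rw [hn, one_mul] at this
    exact (hU' x hx).trans this
  have hxz : ∀ x ∈ U, x ≠ z := fun x hx h => by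
    have := hdist x hx
    rw [h, sub_self, norm_zero] at this
    linarith
  have hq0 : ∀ x ∈ U, 0 < ‖x - z‖ ^ 2 := fun x hx => by
    have := hr.trans_le (hdist x hx)
    positivity
  set η : E2 → ℝ := fun x => (‖x - z‖ ^ 2) ^ (-(3 / 8) : ℝ) with hη
  have hηnn : ∀ x, 0 ≤ η x := fun x => by positivity
  have hηs : ContDiffOn ℝ (⊤ : ℕ∞) η U := by
    refine ContDiffOn.rpow_const_of_ne ?_ fun x hx => (hq0 x hx).ne'
    exact ((contDiff_id.sub contDiff_const).norm_sq ℝ).contDiffOn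
  have hgrad : ∀ x ∈ U, ‖gradient η x‖ ^ 2 = 9 / 16 * ((‖x - z‖ ^ 2)⁻¹ * η x ^ 2) := by
    intro x hx
    rw [(hasGradientAt_norm_sub_sq_rpow (hxz x hx) _).gradient, norm_smul, mul_pow,
      Real.norm_eq_abs, sq_abs]
    have := (hq0 x hx).ne'
    change (2 * -(3 / 8) * η x * (‖x - z‖ ^ 2)⁻¹) ^ 2 * ‖x - z‖ ^ 2 = _
    field_simp
    ring
  set m : ℝ := (r ^ 2) ^ (-(3 / 8) : ℝ) with hm
  have hm0 : 0 < m := by positivity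
  have hηm : ∀ x ∈ U, η x ≤ m := fun x hx =>
    Real.rpow_le_rpow_of_nonpos (by positivity) (by gcongr; exact hdist x hx) (by norm_num)
  have hb1 : ∀ x ∈ U, |η x| ≤ m + m / r := fun x hx => by
    rw [abs_of_nonneg (hηnn x)]
    have : 0 ≤ m / r := by positivity
    linarith [hηm x hx]
  have hb2 : ∀ x ∈ U, ‖gradient η x‖ ≤ m + m / r := fun x hx => by
    have : ‖gradient η x‖ ≤ m / r := by
      refine abs_le_of_sq_le_sq' ?_ (by positivity) |>.2
      rw [hgrad x hx, div_pow]
      have h1 : (‖x - z‖ ^ 2)⁻¹ ≤ (r ^ 2)⁻¹ := by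
        gcongr
        exact hdist x hx
      have h2 : η x ^ 2 ≤ m ^ 2 := by
        have := hηm x hx
        have := hηnn x
        gcongr
      calc _ ≤ 1 * ((r ^ 2)⁻¹ * m ^ 2) := by gcongr; norm_num
        _ = _ := by rw [one_mul, inv_mul_eq_div]
    linarith
  obtain ⟨δ, hδ, H⟩ := energy_mul_le hU hηs hb1 hb2 one_pos
  refine ⟨δ, hδ, fun g hg hg1 hgD => ?_⟩
  have hE := H g hg hg1 hgD
  have hH := hardy_halfPlane hU (hg.mul_left hU hηs) hn hpos
  have hqc : Continuous fun x : E2 => ‖x - z‖ ^ 2 := by fun_prop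
  have hgc : ContinuousOn g U := hg.continuous.continuousOn
  have hz : ∀ x ∉ tsupport g, g x = 0 := fun x hx => image_eq_zero_of_notMem_tsupport hx
  have i1 : Integrable fun x => (‖x - z‖ ^ 2)⁻¹ * (η x * g x) ^ 2 :=
    hg.integrable_of_continuousOn hU
      ((hqc.continuousOn.inv₀ fun x hx => (hq0 x hx).ne').mul ((hηs.continuousOn.mul hgc).pow 2))
      fun x hx => by simp [hz x hx]
  have i2 : Integrable fun x => (η x * g x) ^ 2 := (hg.mul_left hU hηs).integrable_sq
  have e1 : (∫ x, ‖gradient η x‖ ^ 2 * g x ^ 2) =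
      9 / 16 * ∫ x, (‖x - z‖ ^ 2)⁻¹ * (η x * g x) ^ 2 := by
    rw [← integral_const_mul]
    refine integral_congr_ae (ae_of_all _ fun x => ?_)
    by_cases hx : x ∈ U
    · simp only [hgrad x hx]
      ring
    · simp [hg.eq_zero hx]
  have e2 : lam * (∫ x, (η x * g x) ^ 2) ≤
      3 / 16 * (∫ x, (‖x - z‖ ^ 2)⁻¹ * (η x * g x) ^ 2) + C := by
    have : C = C * ∫ x, g x ^ 2 := by rw [hg1, mul_one]
    rw [this, ← integral_const_mul, ← integral_const_mul, ← integral_const_mul,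
      ← integral_add (i1.const_mul _) (hg.integrable_sq.const_mul _)]
    refine integral_mono (i2.const_mul _)
      ((i1.const_mul _).add (hg.integrable_sq.const_mul _)) fun x => ?_
    by_cases hx : x ∈ U
    · have hq := hq0 x hx
      rw [mul_pow]
      change lam * (η x ^ 2 * g x ^ 2) ≤
        3 / 16 * ((‖x - z‖ ^ 2)⁻¹ * (η x ^ 2 * g x ^ 2)) + C * g x ^ 2
      have key : lam * η x ^ 2 ≤ 3 / 16 * ((‖x - z‖ ^ 2)⁻¹ * η x ^ 2) + C := by
        rcases le_or_gt (lam * ‖x - z‖ ^ 2) (3 / 16) with h | h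
        · have : lam ≤ 3 / 16 * (‖x - z‖ ^ 2)⁻¹ := by
            rw [← div_eq_mul_inv, le_div_iff₀ hq]
            exact h
          nlinarith [sq_nonneg (η x)]
        · have h3 : 3 / (16 * (lam + 1)) ≤ ‖x - z‖ ^ 2 := by
            rw [div_le_iff₀ (by positivity)]
            nlinarith
          have h4 : η x ≤ (3 / (16 * (lam + 1))) ^ (-(3 / 8) : ℝ) :=
            Real.rpow_le_rpow_of_nonpos (by positivity) h3 (by norm_num)
          have h5 : lam * η x ^ 2 ≤ C := by
            have := hηnn x
            rw [hC]
            gcongr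
          have : 0 ≤ 3 / 16 * ((‖x - z‖ ^ 2)⁻¹ * η x ^ 2) := by positivity
          linarith
      nlinarith [sq_nonneg (g x)]
    · simp [hg.eq_zero hx]
  rw [e1] at hE
  change (∫ x, (‖x - z‖ ^ 2)⁻¹ * (η x * g x) ^ 2) ≤ _
  linarith

set_option maxHeartbeats 400000 in
/-- Removing a neighbourhood of size `r` of a boundary point at which `U` has a supporting line
raises the principal eigenvalue by at most a multiple of `r ^ (3 / 2)`. -/
lemma exists_eigen_le_add_rpow {U : Set E2} (hU : IsOpen U) (hUb : Bornology.IsBounded U)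
    (hne : U.Nonempty) {n x₀ : E2} (hn : ‖n‖ = 1) (hpos : ∀ x ∈ U, 0 < inner ℝ n (x - x₀)) :
    ∃ C > 0, ∃ r₁ > 0, ∀ r, 0 < r → r < r₁ → ∀ W : Set E2, IsOpen W →
      (∀ x ∈ U, r < ‖x - x₀‖ → x ∈ W) → eigen W ≤ eigen U + C * r ^ (3 / 2 : ℝ) := by
  obtain ⟨M, hM, HM⟩ := integral_weight_le hU
  let f : ContDiffBump (0 : E2) := ⟨2, 3, by norm_num, by norm_num⟩
  have hfs : ContDiff ℝ (⊤ : ℕ∞) f := f.contDiff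
  obtain ⟨C₁, hC₁⟩ : ∃ C₁, ∀ x, ‖fderiv ℝ f x‖ ≤ C₁ :=
    (hfs.continuous_fderiv (by simp)).bounded_above_of_compact_support
      (f.hasCompactSupport.fderiv (𝕜 := ℝ))
  have hC₁0 : 0 ≤ C₁ := (norm_nonneg _).trans (hC₁ 0)
  set lam := eigen U with hlam
  have hlam0 : 0 ≤ lam := eigen_nonneg U
  set K : ℝ := 16 ^ (7 / 4 : ℝ) with hK
  have hK0 : 0 < K := by positivity
  obtain ⟨r₁, hr₁, hr₁1, hr₁2⟩ : ∃ r₁ > (0 : ℝ), r₁ ≤ 1 ∧ K * r₁ * M ≤ 1 / 2 := by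
    refine ⟨min 1 (1 / (2 * K * M)), by positivity, min_le_left _ _, ?_⟩
    calc K * min 1 (1 / (2 * K * M)) * M ≤ K * (1 / (2 * K * M)) * M := by
          gcongr
          exact min_le_right _ _
      _ = 1 / 2 := by field_simp
  refine ⟨2 * (C₁ ^ 2 * K * M + 1), by positivity, r₁, hr₁, fun r hr hrr W hW hUW => ?_⟩
  set z := x₀ - r • n with hz
  have hzU : ∀ x ∈ U, r ≤ inner ℝ n (x - z) := fun x hx => by
    have : x - z = (x - x₀) + r • n := by rw [hz]; abel
    rw [this, inner_add_right, inner_smul_right, real_inner_self_eq_norm_sq, hn]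
    have := hpos x hx
    linarith
  obtain ⟨δ₁, hδ₁, H₁⟩ := HM n z r hr hn hzU
  have hdist : ∀ x ∈ U, r ≤ ‖x - z‖ := fun x hx => by
    have := real_inner_le_norm n (x - z)
    rw [hn, one_mul] at this
    exact (hzU x hx).trans this
  have hq0 : ∀ x ∈ U, 0 < ‖x - z‖ ^ 2 := fun x hx => by
    have := hr.trans_le (hdist x hx)
    positivity
  set χ : E2 → ℝ := fun x => 1 - f (r⁻¹ • (x - x₀)) with hχ
  have hχs : ContDiff ℝ (⊤ : ℕ∞) χ :=
    contDiff_const.sub (hfs.comp ((contDiff_id.sub contDiff_const).const_smul _))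
  have hχ01 : ∀ x, 0 ≤ χ x ∧ χ x ≤ 1 := fun x =>
    ⟨sub_nonneg.2 f.le_one, sub_le_self _ f.nonneg⟩
  have hχfar : ∀ x, 3 * r < ‖x - x₀‖ → χ x = 1 := fun x hx => by
    have : f (r⁻¹ • (x - x₀)) = 0 := by
      refine f.zero_of_le_dist ?_
      rw [dist_zero_right, norm_smul, norm_inv, Real.norm_of_nonneg hr.le, ← div_eq_inv_mul,
        le_div_iff₀ hr]
      exact hx.le
    simp [hχ, this]
  have hχnear : ∀ x, ‖x - x₀‖ ≤ 2 * r → χ x = 0 := fun x hx => by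
    have : f (r⁻¹ • (x - x₀)) = 1 := by
      refine f.one_of_mem_closedBall ?_
      rw [mem_closedBall, dist_zero_right, norm_smul, norm_inv, Real.norm_of_nonneg hr.le,
        ← div_eq_inv_mul, div_le_iff₀ hr]
      exact hx
    simp [hχ, this]
  have hχg : ∀ x, ‖gradient χ x‖ ≤ C₁ / r := fun x => by
    have h1 : HasFDerivAt χ (-((fderiv ℝ f (r⁻¹ • (x - x₀))).comp
        (r⁻¹ • ContinuousLinearMap.id ℝ E2))) x := by
      have h2 : HasFDerivAt (fun y : E2 => r⁻¹ • (y - x₀))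
          (r⁻¹ • ContinuousLinearMap.id ℝ E2) x :=
        ((hasFDerivAt_id (𝕜 := ℝ) x).sub_const x₀).const_smul r⁻¹
      exact ((hfs.differentiable (by simp) _).hasFDerivAt.comp x h2).const_sub 1
    rw [gradient, LinearIsometryEquiv.norm_map, h1.fderiv, norm_neg]
    refine (ContinuousLinearMap.opNorm_comp_le _ _).trans ?_
    rw [div_eq_mul_inv, norm_smul, norm_inv, Real.norm_of_nonneg hr.le]
    have := ContinuousLinearMap.norm_id_le (𝕜 := ℝ) (E := E2)
    calc _ ≤ C₁ * (r⁻¹ * 1) := by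
          gcongr
          exact hC₁ _
      _ = _ := by rw [mul_one]
  have hχg0 : ∀ x, 3 * r < ‖x - x₀‖ → gradient χ x = 0 := fun x hx => by
    have : χ =ᶠ[nhds x] fun _ => 1 := by
      have ho : IsOpen {y : E2 | 3 * r < ‖y - x₀‖} :=
        isOpen_lt continuous_const (by fun_prop)
      filter_upwards [ho.mem_nhds hx] with y hy using hχfar y hy
    rw [this.gradient_eq]
    exact gradient_fun_const x (1 : ℝ)
  obtain ⟨δ₂, hδ₂, H₂⟩ := energy_mul_le hU hχs.contDiffOn (M := 1 + C₁ / r)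
    (fun x _ => by
      rw [abs_of_nonneg (hχ01 x).1]
      have : 0 ≤ C₁ / r := by positivity
      linarith [(hχ01 x).2])
    (fun x _ => by linarith [hχg x]) (ε := r ^ (3 / 2 : ℝ)) (by positivity)
  obtain ⟨g, hg, hg1, hgD⟩ := exists_testFn_near_eigen hU hUb hne (lt_min hδ₁ hδ₂)
  have hw := H₁ g hg hg1 (hgD.trans (by gcongr; exact min_le_left _ _))
  have hE := H₂ g hg hg1 (hgD.trans (by gcongr; exact min_le_right _ _))
  set w : E2 → ℝ := fun x => (‖x - z‖ ^ 2)⁻¹ * ((‖x - z‖ ^ 2) ^ (-(3 / 8) : ℝ) * g x) ^ 2 with hwdef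
  have hw0 : ∀ x, 0 ≤ w x := fun x => by positivity
  have hwi : Integrable w := by
    have hqc : Continuous fun x : E2 => ‖x - z‖ ^ 2 := by fun_prop
    refine hg.integrable_of_continuousOn hU ((hqc.continuousOn.inv₀ fun x hx => (hq0 x hx).ne').mul
      (((hqc.continuousOn.rpow_const fun x hx => Or.inl (hq0 x hx).ne').mul
        hg.continuous.continuousOn).pow 2)) fun x hx => ?_
    simp [hwdef, image_eq_zero_of_notMem_tsupport hx]
  have hnear : ∀ x, ‖x - x₀‖ ≤ 3 * r → g x ^ 2 ≤ K * r ^ (7 / 2 : ℝ) * w x := fun x hx => by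
    by_cases hxU : x ∈ U
    · have hq := hq0 x hxU
      have hxz : ‖x - z‖ ≤ 4 * r := by
        have : x - z = (x - x₀) + r • n := by rw [hz]; abel
        rw [this]
        refine (norm_add_le _ _).trans ?_
        rw [norm_smul, hn, Real.norm_of_nonneg hr.le]
        linarith
      have e1 : w x = (‖x - z‖ ^ 2) ^ (-(7 / 4) : ℝ) * g x ^ 2 := by
        rw [hwdef]
        simp only
        rw [mul_pow, ← mul_assoc, ← Real.rpow_neg_one, ← Real.rpow_natCast
          ((‖x - z‖ ^ 2) ^ (-(3 / 8) : ℝ)), ← Real.rpow_mul hq.le, ← Real.rpow_add hq]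
        norm_num
      have e2 : K * r ^ (7 / 2 : ℝ) = (16 * r ^ 2) ^ (7 / 4 : ℝ) := by
        rw [Real.mul_rpow (by norm_num) (by positivity), ← Real.rpow_natCast r 2,
          ← Real.rpow_mul hr.le]
        norm_num [hK]
      have e3 : 1 ≤ (16 * r ^ 2) ^ (7 / 4 : ℝ) * (‖x - z‖ ^ 2) ^ (-(7 / 4) : ℝ) := by
        rw [Real.rpow_neg hq.le, ← div_eq_mul_inv, one_le_div (by positivity)]
        refine Real.rpow_le_rpow hq.le ?_ (by norm_num)
        have := norm_nonneg (x - z)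
        nlinarith
      rw [e1, e2, ← mul_assoc]
      exact le_mul_of_one_le_left (sq_nonneg _) e3
    · rw [hg.eq_zero hxU]
      have := hw0 x
      simp only [ne_eq, OfNat.ofNat_ne_zero, not_false_eq_true, zero_pow]
      positivity
  have hr32 : r ^ (7 / 2 : ℝ) = r ^ 2 * r ^ (3 / 2 : ℝ) := by
    rw [← Real.rpow_natCast r 2, ← Real.rpow_add hr]
    norm_num
  have hr1 : r ≤ 1 := hrr.le.trans hr₁1
  have hr72 : r ^ (7 / 2 : ℝ) ≤ r := by
    calc r ^ (7 / 2 : ℝ) ≤ r ^ (1 : ℝ) :=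
          Real.rpow_le_rpow_of_exponent_ge hr hr1 (by norm_num)
      _ = r := Real.rpow_one r
  have hgu : TestFn U (fun x => χ x * g x) := hg.mul_left hU hχs.contDiffOn
  have hgW : TestFn W (fun x => χ x * g x) := by
    refine ⟨hgu.contDiff, fun x hx => ?_, hgu.hasCompactSupport⟩
    refine hUW x (hgu.tsupport_subset hx) ?_
    by_contra hlt
    refine notMem_tsupport_iff_eventuallyEq.2 ?_ hx
    have ho : IsOpen {y : E2 | ‖y - x₀‖ < 2 * r} := isOpen_lt (by fun_prop) continuous_const
    filter_upwards [ho.mem_nhds (show ‖x - x₀‖ < 2 * r by linarith)] with y hy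
    simp [hχnear y (le_of_lt hy)]
  have hN : 1 / 2 ≤ ∫ x, (χ x * g x) ^ 2 := by
    have h1 : (∫ x, g x ^ 2) ≤ ∫ x, ((χ x * g x) ^ 2 + K * r ^ (7 / 2 : ℝ) * w x) := by
      refine integral_mono hg.integrable_sq (hgu.integrable_sq.add (hwi.const_mul _)) fun x => ?_
      rcases le_or_gt ‖x - x₀‖ (3 * r) with h | h
      · have := hnear x h
        simp only
        nlinarith [sq_nonneg (χ x * g x)]
      · have := hw0 x
        have h0 : 0 ≤ K * r ^ (7 / 2 : ℝ) * w x := by positivity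
        simp only [hχfar x h, one_mul]
        linarith
    rw [integral_add hgu.integrable_sq (hwi.const_mul _), integral_const_mul, hg1] at h1
    have h2 : K * r ^ (7 / 2 : ℝ) * ∫ x, w x ≤ K * r₁ * M := by
      have h3 : 0 ≤ ∫ x, w x := integral_nonneg hw0
      exact mul_le_mul (mul_le_mul_of_nonneg_left (hr72.trans hrr.le) hK0.le) hw h3 (by positivity)
    linarith
  have hgr : (∫ x, ‖gradient χ x‖ ^ 2 * g x ^ 2) ≤ C₁ ^ 2 * K * M * r ^ (3 / 2 : ℝ) := by
    have h1 : (∫ x, ‖gradient χ x‖ ^ 2 * g x ^ 2) ≤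
        ∫ x, (C₁ / r) ^ 2 * (K * r ^ (7 / 2 : ℝ) * w x) := by
      refine integral_mono ?_ ((hwi.const_mul _).const_mul _) fun x => ?_
      · refine hg.integrable_of_continuousOn hU
          ((((continuous_gradient hχs).norm.pow 2).mul (hg.continuous.pow 2)).continuousOn)
          fun x hx => ?_
        simp [image_eq_zero_of_notMem_tsupport hx]
      · have h0 := hw0 x
        rcases le_or_gt ‖x - x₀‖ (3 * r) with h | h
        · have := hnear x h
          have := hχg x
          simp only
          gcongr
        · simp only [hχg0 x h]
          simp only [norm_zero, ne_eq, OfNat.ofNat_ne_zero, not_false_eq_true, zero_pow, zero_mul]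
          positivity
    rw [integral_const_mul, integral_const_mul] at h1
    refine h1.trans ?_
    calc (C₁ / r) ^ 2 * (K * r ^ (7 / 2 : ℝ) * ∫ x, w x)
        ≤ (C₁ / r) ^ 2 * (K * r ^ (7 / 2 : ℝ) * M) :=
          mul_le_mul_of_nonneg_left (mul_le_mul_of_nonneg_left hw (by positivity)) (by positivity)
      _ = _ := by
        rw [hr32]
        field_simp
  have hR := eigen_mul_integral_sq_le hW hgW
  set N := ∫ x, (χ x * g x) ^ 2
  have hfin : (eigen W - lam) * N ≤ (C₁ ^ 2 * K * M + 1) * r ^ (3 / 2 : ℝ) := by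
    linarith
  have hT : 0 ≤ (C₁ ^ 2 * K * M + 1) * r ^ (3 / 2 : ℝ) := by positivity
  by_contra hcon
  push Not at hcon
  nlinarith

/-- A convex set obtained from `U` by replacing a boundary arc with a chord is the part of `U` on
one side of the chord. -/
lemma exists_chord_functional {U V S : Set E2} (hUo : IsOpen U) (hUc : Convex ℝ U)
    (hVo : IsOpen V) (hVc : Convex ℝ V) (hVU : V ⊆ U) {P Q x₀ : E2} (hx₀ : x₀ ∈ frontier U)
    (hx₀S : x₀ ∈ S) (hx₀seg : x₀ ∉ segment ℝ P Q)
    (hfr : frontier V = (frontier U \ S) ∪ segment ℝ P Q) :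
    V.Nonempty ∧ ∃ f : E2 →L[ℝ] ℝ, f P = f Q ∧ f P < f x₀ ∧ V = {x | x ∈ U ∧ f x < f P} ∧
      ∀ x ∈ U, f x = f P → x ∈ segment ℝ P Q := by
  have hsegV : segment ℝ P Q ⊆ frontier V := hfr ▸ subset_union_right
  have hVne : V.Nonempty := by
    by_contra h
    rw [not_nonempty_iff_eq_empty] at h
    have := hsegV (left_mem_segment ℝ P Q)
    simp [h] at this
  refine ⟨hVne, ?_⟩
  have hnotU : ∀ {x}, x ∈ frontier U → x ∉ U := fun hx => by
    rw [hUo.frontier_eq] at hx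
    exact hx.2
  have hfrV : ∀ {x}, x ∈ frontier V ↔ x ∈ closure V ∧ x ∉ V := by
    intro x
    rw [hVo.frontier_eq]
    rfl
  have hm := hfrV.1 (hsegV (midpoint_mem_segment P Q))
  obtain ⟨f, hf⟩ := geometric_hahn_banach_open_point hVc hVo hm.2
  have hcl : ∀ x ∈ closure V, f x ≤ f (midpoint ℝ P Q) := fun x hx =>
    closure_minimal (t := {x | f x ≤ f (midpoint ℝ P Q)}) (fun y hy => (hf y hy).le)
      (isClosed_le f.continuous continuous_const) hx
  have hP := hcl P (hfrV.1 (hsegV (left_mem_segment ℝ P Q))).1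
  have hQ := hcl Q (hfrV.1 (hsegV (right_mem_segment ℝ P Q))).1
  have hmid : f (midpoint ℝ P Q) = (f P + f Q) / 2 := by
    rw [midpoint_eq_smul_add, map_smul, map_add]
    simp
    ring
  have hPQ : f P = f Q := by linarith
  have hmP : f (midpoint ℝ P Q) = f P := by linarith
  rw [hmP] at hf
  have hseg : ∀ x ∈ segment ℝ P Q, f x = f P := by
    rintro x ⟨a, b, -, -, hab, rfl⟩
    rw [map_add, map_smul, map_smul, ← hPQ, ← add_smul, hab, one_smul]
  set W : Set E2 := {x | x ∈ U ∧ f x < f P} with hW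
  have hWc : Convex ℝ W := hUc.inter (convex_halfSpace_lt f.toLinearMap.isLinear _)
  have hWV : W ⊆ V := by
    refine hWc.isPreconnected.subset_of_closure_inter_subset hVo ?_ ?_
    · obtain ⟨o, ho⟩ := hVne
      exact ⟨o, ⟨hVU ho, hf o ho⟩, ho⟩
    · rintro x ⟨hx, hxU, hxf⟩
      by_contra hxV
      have := hfrV.2 ⟨hx, hxV⟩
      rw [hfr] at this
      rcases this with h | h
      · exact hnotU h.1 hxU
      · exact hxf.ne (hseg x h)
  obtain ⟨o, ho⟩ := hVne
  have hlim : ∀ x, openSegment ℝ o x ⊆ U → f x ≤ f P → x ∈ closure V := fun x hx hxf => by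
    have h1 : openSegment ℝ o x ⊆ V := by
      intro y hy
      refine hWV ⟨hx hy, ?_⟩
      obtain ⟨a, b, ha, hb, hab, rfl⟩ := hy
      rw [map_add, map_smul, map_smul, smul_eq_mul, smul_eq_mul]
      have := hf o ho
      have hab' : b = 1 - a := by linarith
      subst hab'
      nlinarith
    have h2 : x ∈ closure (openSegment ℝ o x) := by
      rw [closure_openSegment]
      exact right_mem_segment ℝ o x
    exact closure_mono h1 h2
  have hfr' : ∀ x ∈ frontier V, x ∈ frontier U \ S ∨ x ∈ segment ℝ P Q := fun x hx => by
    rw [hfr] at hx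
    exact hx
  refine ⟨f, hPQ, ?_, Subset.antisymm (fun x hx => ⟨hVU hx, hf x hx⟩) hWV, ?_⟩
  · by_contra! h
    have h1 : openSegment ℝ o x₀ ⊆ U := by
      have := hUc.openSegment_interior_closure_subset_interior
        (by rw [hUo.interior_eq]; exact hVU ho) (frontier_subset_closure hx₀)
      rwa [hUo.interior_eq] at this
    rcases hfr' x₀ (hfrV.2 ⟨hlim x₀ h1 h, fun h => hnotU hx₀ (hVU h)⟩) with h | h
    · exact h.2 hx₀S
    · exact hx₀seg h
  · intro x hx hxf
    have h1 : openSegment ℝ o x ⊆ U := hUc.openSegment_subset (hVU ho) hx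
    rcases hfr' x (hfrV.2 ⟨hlim x h1 hxf.le, fun h => (hf x h).ne hxf⟩) with h | h
    · exact absurd hx (hnotU h.1)
    · exact h

/-- A bounded open convex neighbourhood of the origin in the complex plane. -/
structure IsRadialBody (K : Set ℂ) : Prop where
  isOpen : IsOpen K
  convex : Convex ℝ K
  isBounded : Bornology.IsBounded K
  zero_mem : (0 : ℂ) ∈ K

/-- The unit vector with angle `θ`. -/
def unitDir (θ : ℝ) : ℂ := Complex.exp (θ * Complex.I)

/-- The boundary point of `K` in direction `θ`. -/
def radial (K : Set ℂ) (θ : ℝ) : ℂ := (gauge K (unitDir θ))⁻¹ • unitDir θ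

lemma norm_unitDir (θ : ℝ) : ‖unitDir θ‖ = 1 := Complex.norm_exp_ofReal_mul_I θ

lemma unitDir_ne_zero (θ : ℝ) : unitDir θ ≠ 0 := Complex.exp_ne_zero _

lemma unitDir_add_two_pi (θ : ℝ) : unitDir (θ + 2 * Real.pi) = unitDir θ := by
  have := Complex.exp_mul_I_periodic (θ : ℂ)
  simpa [unitDir] using this

lemma unitDir_re (θ : ℝ) : (unitDir θ).re = Real.cos θ := Complex.exp_ofReal_mul_I_re θ

lemma unitDir_im (θ : ℝ) : (unitDir θ).im = Real.sin θ := Complex.exp_ofReal_mul_I_im θ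

lemma lipschitzWith_unitDir : LipschitzWith 1 unitDir := by
  have hd : ∀ θ : ℝ, HasDerivAt unitDir (unitDir θ * Complex.I) θ := fun θ => by
    have := ((Complex.ofRealCLM.hasDerivAt (x := θ)).mul_const Complex.I).cexp
    simp only [Complex.ofRealCLM_apply, Complex.ofReal_one, one_mul] at this
    exact this
  refine lipschitzWith_of_nnnorm_deriv_le (fun θ => (hd θ).differentiableAt) fun θ => ?_
  rw [(hd θ).deriv, ← NNReal.coe_le_coe, coe_nnnorm, norm_mul, norm_unitDir]
  simp

lemma unitDir_eq_unitDir_iff {θ φ : ℝ} :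
    unitDir θ = unitDir φ ↔ ∃ k : ℤ, θ = φ + k * (2 * Real.pi) := by
  rw [unitDir, unitDir, Complex.exp_eq_exp_iff_exists_int]
  refine exists_congr fun k => ?_
  have : (φ : ℂ) * Complex.I + k * (2 * Real.pi * Complex.I) =
      ((φ + k * (2 * Real.pi) : ℝ) : ℂ) * Complex.I := by
    push_cast
    ring
  rw [this, mul_left_inj' Complex.I_ne_zero, Complex.ofReal_inj]

lemma radial_add_two_pi (K : Set ℂ) (θ : ℝ) : radial K (θ + 2 * Real.pi) = radial K θ := by
  simp only [radial, unitDir_add_two_pi]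

namespace IsRadialBody

variable {K : Set ℂ}

lemma mem_nhds (hK : IsRadialBody K) : K ∈ nhds (0 : ℂ) := hK.isOpen.mem_nhds hK.zero_mem

lemma gauge_unitDir_pos (hK : IsRadialBody K) (θ : ℝ) : 0 < gauge K (unitDir θ) :=
  (gauge_pos (absorbent_nhds_zero hK.mem_nhds)
    (NormedSpace.isVonNBounded_iff ℝ |>.2 hK.isBounded)).2 (unitDir_ne_zero θ)

lemma radial_eq_of_mem_frontier (hK : IsRadialBody K) {w : ℂ} (hw : w ∈ frontier K) {l θ : ℝ}
    (hl : 0 < l) (h : w = l • unitDir θ) : radial K θ = w := by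
  have h1 := (gauge_eq_one_iff_mem_frontier hK.convex hK.mem_nhds).2 hw
  rw [h, gauge_smul_of_nonneg hl.le, smul_eq_mul] at h1
  rw [radial, h, ← eq_inv_of_mul_eq_one_left h1]

lemma radial_mem_frontier (hK : IsRadialBody K) (θ : ℝ) : radial K θ ∈ frontier K := by
  have h := hK.gauge_unitDir_pos θ
  rw [← gauge_eq_one_iff_mem_frontier hK.convex hK.mem_nhds, radial,
    gauge_smul_of_nonneg (by positivity), smul_eq_mul, inv_mul_cancel₀ h.ne']

lemma ne_zero_of_mem_frontier (hK : IsRadialBody K) {w : ℂ} (hw : w ∈ frontier K) : w ≠ 0 := by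
  rintro rfl
  rw [hK.isOpen.frontier_eq] at hw
  exact hw.2 hK.zero_mem

lemma radial_arg (hK : IsRadialBody K) {w : ℂ} (hw : w ∈ frontier K) : radial K w.arg = w :=
  hK.radial_eq_of_mem_frontier hw (norm_pos_iff.2 (hK.ne_zero_of_mem_frontier hw))
    (by rw [unitDir, Complex.real_smul, Complex.norm_mul_exp_arg_mul_I])

lemma unitDir_eq_of_radial_eq (hK : IsRadialBody K) {θ φ : ℝ} (h : radial K θ = radial K φ) :
    unitDir θ = unitDir φ := by
  have hθ := hK.gauge_unitDir_pos θ
  have hφ := hK.gauge_unitDir_pos φ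
  have h1 : ‖radial K θ‖ = ‖radial K φ‖ := by rw [h]
  rw [radial, radial, norm_smul, norm_smul, norm_unitDir, norm_unitDir, mul_one, mul_one,
    Real.norm_of_nonneg (by positivity), Real.norm_of_nonneg (by positivity)] at h1
  rw [radial, radial, h1] at h
  exact smul_right_injective ℂ (inv_pos.2 hφ).ne' h

lemma injOn_radial (hK : IsRadialBody K) (θ₀ : ℝ) :
    InjOn (radial K) (Ico θ₀ (θ₀ + 2 * Real.pi)) := by
  intro θ hθ φ hφ h
  obtain ⟨k, hk⟩ := unitDir_eq_unitDir_iff.1 (hK.unitDir_eq_of_radial_eq h)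
  have hpi := Real.pi_pos
  have h1 : (k : ℝ) < 1 := by
    by_contra! hc
    nlinarith [hθ.2, hφ.1]
  have h2 : (-1 : ℝ) < k := by
    by_contra! hc
    nlinarith [hθ.1, hφ.2]
  have : k = 0 := by
    have h1' : k < 1 := by exact_mod_cast h1
    have h2' : -1 < k := by exact_mod_cast h2
    omega
  simpa [this] using hk

lemma exists_radial_eq (hK : IsRadialBody K) {w : ℂ} (hw : w ∈ frontier K) (θ₀ : ℝ) :
    ∃ θ ∈ Ico θ₀ (θ₀ + 2 * Real.pi), radial K θ = w := by
  refine ⟨toIcoMod Real.two_pi_pos θ₀ w.arg, toIcoMod_mem_Ico _ _ _, ?_⟩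
  have : unitDir (toIcoMod Real.two_pi_pos θ₀ w.arg) = unitDir w.arg := by
    refine unitDir_eq_unitDir_iff.2 ⟨-toIcoDiv Real.two_pi_pos θ₀ w.arg, ?_⟩
    have := toIcoMod_add_toIcoDiv_zsmul Real.two_pi_pos θ₀ w.arg
    rw [zsmul_eq_mul] at this
    push_cast
    linarith
  rw [radial, this]
  exact hK.radial_arg hw

lemma exists_lipschitzWith_radial (hK : IsRadialBody K) : ∃ C, LipschitzWith C (radial K) := by
  obtain ⟨L, hL⟩ := hK.convex.lipschitz_gauge hK.mem_nhds
  obtain ⟨R, hR0, hR⟩ := hK.isBounded.subset_closedBall_lt 0 0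
  have hlow : ∀ θ, R⁻¹ ≤ gauge K (unitDir θ) := fun θ => by
    have := le_gauge_of_subset_closedBall (x := unitDir θ) (absorbent_nhds_zero hK.mem_nhds)
      hR0.le hR
    rwa [norm_unitDir, one_div] at this
  have hinv : ∀ θ, (gauge K (unitDir θ))⁻¹ ≤ R := fun θ => by
    have := inv_anti₀ (inv_pos.2 hR0) (hlow θ)
    rwa [inv_inv] at this
  refine ⟨⟨R * (R * L) + R, by positivity⟩, LipschitzWith.of_dist_le_mul fun θ φ => ?_⟩
  have hθ := hK.gauge_unitDir_pos θ
  have hφ := hK.gauge_unitDir_pos φ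
  have hu : ‖unitDir θ - unitDir φ‖ ≤ |θ - φ| := by
    have := lipschitzWith_unitDir.dist_le_mul θ φ
    simpa [dist_eq_norm] using this
  have hg : |gauge K (unitDir φ) - gauge K (unitDir θ)| ≤ L * |θ - φ| := by
    have := hL.dist_le_mul (unitDir φ) (unitDir θ)
    rw [Real.dist_eq, dist_comm, dist_eq_norm] at this
    exact this.trans (by gcongr)
  have hsplit : radial K θ - radial K φ =
      ((gauge K (unitDir θ))⁻¹ - (gauge K (unitDir φ))⁻¹) • unitDir θ +
        (gauge K (unitDir φ))⁻¹ • (unitDir θ - unitDir φ) := by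
    rw [radial, radial, sub_smul, smul_sub]
    abel
  have hd : |(gauge K (unitDir θ))⁻¹ - (gauge K (unitDir φ))⁻¹| ≤ R * (R * L) * |θ - φ| := by
    have : (gauge K (unitDir θ))⁻¹ - (gauge K (unitDir φ))⁻¹ = (gauge K (unitDir θ))⁻¹ *
        ((gauge K (unitDir φ))⁻¹ * (gauge K (unitDir φ) - gauge K (unitDir θ))) := by
      field_simp
    rw [this, abs_mul, abs_mul, abs_of_pos (inv_pos.2 hθ), abs_of_pos (inv_pos.2 hφ), mul_assoc,
      mul_assoc]
    have h1 := hinv θ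
    have h2 := hinv φ
    gcongr
  rw [dist_eq_norm, Real.dist_eq, hsplit]
  refine (norm_add_le _ _).trans ?_
  rw [norm_smul, norm_smul, norm_unitDir, mul_one, Real.norm_eq_abs,
    Real.norm_of_nonneg (inv_pos.2 hφ).le]
  have h2 := hinv φ
  calc _ ≤ R * (R * L) * |θ - φ| + R * |θ - φ| := by gcongr
    _ = (R * (R * L) + R) * |θ - φ| := by ring

/-- A simple closed curve in the boundary of `K` varies at most as much as the radial
parametrization. -/
lemma eVariationOn_comp_le (hK : IsRadialBody K) {E : Type*} [PseudoEMetricSpace E] (F : ℂ → E)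
    {δ : ℝ → ℂ} (hc : ContinuousOn δ (Icc 0 1)) (h01 : δ 0 = δ 1) (hi : InjOn δ (Ico 0 1))
    (hfr : ∀ t ∈ Icc (0 : ℝ) 1, δ t ∈ frontier K) {θ₀ : ℝ} (hθ₀ : radial K θ₀ = δ 0) :
    eVariationOn (fun t => F (δ t)) (Icc 0 1) ≤
      eVariationOn (fun θ => F (radial K θ)) (Icc θ₀ (θ₀ + 2 * Real.pi)) := by
  have hpi := Real.pi_pos
  set v : ℝ → ℂ := fun t => -(δ t * unitDir (-θ₀)) with hv
  set α : ℝ → ℝ := fun t => θ₀ + Real.pi + (v t).arg with hα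
  have huu : unitDir (-θ₀) * unitDir θ₀ = 1 := by
    rw [unitDir, unitDir, ← Complex.exp_add]
    simp
  have hrot : ∀ t, δ t = ‖v t‖ • unitDir (α t) := fun t => by
    have h1 : unitDir (α t) = -(unitDir θ₀ * Complex.exp ((v t).arg * Complex.I)) := by
      simp only [unitDir, hα]
      push_cast
      rw [add_mul, add_mul, Complex.exp_add, Complex.exp_add, Complex.exp_pi_mul_I]
      ring
    rw [h1, Complex.real_smul, mul_neg, mul_left_comm, Complex.norm_mul_exp_arg_mul_I, hv]
    simp only
    linear_combination -(δ t) * huu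
  have hv0 : ∀ t ∈ Icc (0 : ℝ) 1, v t ≠ 0 := fun t ht => by
    simp [hv, hK.ne_zero_of_mem_frontier (hfr t ht), unitDir_ne_zero]
  have hrad : ∀ t ∈ Icc (0 : ℝ) 1, radial K (α t) = δ t := fun t ht =>
    hK.radial_eq_of_mem_frontier (hfr t ht) (norm_pos_iff.2 (hv0 t ht)) (hrot t)
  have hsl : ∀ t ∈ Ioo (0 : ℝ) 1, v t ∈ Complex.slitPlane := fun t ht => by
    have htI : t ∈ Icc (0 : ℝ) 1 := Ioo_subset_Icc_self ht
    rw [Complex.mem_slitPlane_iff_arg]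
    refine ⟨fun harg => ?_, hv0 t htI⟩
    have h1 : α t = θ₀ + 2 * Real.pi := by
      simp only [hα, harg]
      ring
    have h2 := hrad t htI
    rw [h1, radial_add_two_pi, hθ₀] at h2
    exact ht.1.ne (hi ⟨le_rfl, one_pos⟩ ⟨ht.1.le, ht.2⟩ h2)
  have hαm : ∀ t ∈ Ioo (0 : ℝ) 1, α t ∈ Ioo θ₀ (θ₀ + 2 * Real.pi) := fun t ht => by
    have h1 := Complex.neg_pi_lt_arg (v t)
    have h2 := Complex.arg_le_pi (v t)
    have h3 := (Complex.mem_slitPlane_iff_arg.1 (hsl t ht)).1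
    have h4 := lt_of_le_of_ne h2 h3
    constructor <;> simp only [hα] <;> linarith
  have hαc : ContinuousOn α (Ioo 0 1) := fun t ht => by
    have h1 : ContinuousWithinAt v (Ioo 0 1) t :=
      (((hc.mono Ioo_subset_Icc_self) t ht).mul continuousWithinAt_const).neg
    exact ((Complex.continuousAt_arg (hsl t ht)).comp_continuousWithinAt h1).const_add _
  have hαi : InjOn α (Ioo 0 1) := fun t ht t' ht' h => by
    refine hi (Ioo_subset_Ico_self ht) (Ioo_subset_Ico_self ht') ?_
    rw [← hrad t (Ioo_subset_Icc_self ht), ← hrad t' (Ioo_subset_Icc_self ht'), h]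
  have hend : radial K (θ₀ + 2 * Real.pi) = δ 0 := by rw [radial_add_two_pi, hθ₀]
  have main : ∀ ψ : ℝ → ℝ, (MonotoneOn ψ (Icc 0 1) ∨ AntitoneOn ψ (Icc 0 1)) →
      MapsTo ψ (Icc 0 1) (Icc θ₀ (θ₀ + 2 * Real.pi)) →
      (∀ t ∈ Icc (0 : ℝ) 1, radial K (ψ t) = δ t) →
      eVariationOn (fun t => F (δ t)) (Icc 0 1) ≤
        eVariationOn (fun θ => F (radial K θ)) (Icc θ₀ (θ₀ + 2 * Real.pi)) := by
    intro ψ hψ hm hr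
    have : eVariationOn (fun t => F (δ t)) (Icc 0 1) =
        eVariationOn ((fun θ => F (radial K θ)) ∘ ψ) (Icc 0 1) :=
      eVariationOn.congr fun t ht => by simp only [Function.comp, hr t ht]
    rw [this]
    rcases hψ with h | h
    · exact eVariationOn.comp_le_of_monotoneOn _ ψ h hm
    · exact eVariationOn.comp_le_of_antitoneOn _ ψ h hm
  rcases hαc.strictMonoOn_of_injOn_Ioo one_pos hαi with hmono | hanti
  · refine main (fun t => if t ≤ 0 then θ₀ else if 1 ≤ t then θ₀ + 2 * Real.pi else α t)
      (Or.inl ?_) ?_ ?_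
    · intro t ht t' ht' htt
      simp only
      split_ifs <;> first
        | linarith
        | exact (hαm t' ⟨not_le.1 ‹_›, not_le.1 ‹_›⟩).1.le
        | exact (hαm t ⟨not_le.1 ‹_›, not_le.1 ‹_›⟩).2.le
        | exact hmono.monotoneOn ⟨not_le.1 ‹_›, not_le.1 ‹_›⟩ ⟨not_le.1 ‹_›, not_le.1 ‹_›⟩ htt
    · intro t ht
      simp only
      split_ifs with h1 h2
      · exact ⟨le_rfl, by linarith⟩
      · exact ⟨by linarith, le_rfl⟩
      · exact Ioo_subset_Icc_self (hαm t ⟨not_le.1 h1, not_le.1 h2⟩)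
    · intro t ht
      split_ifs with h1 h2
      · rw [hθ₀, le_antisymm h1 ht.1]
      · rw [hend, h01, le_antisymm ht.2 h2]
      · exact hrad t ht
  · refine main (fun t => if t ≤ 0 then θ₀ + 2 * Real.pi else if 1 ≤ t then θ₀ else α t)
      (Or.inr ?_) ?_ ?_
    · intro t ht t' ht' htt
      simp only
      split_ifs <;> first
        | linarith
        | exact (hαm t ⟨not_le.1 ‹_›, not_le.1 ‹_›⟩).1.le
        | exact (hαm t' ⟨not_le.1 ‹_›, not_le.1 ‹_›⟩).2.le
        | exact hanti.antitoneOn ⟨not_le.1 ‹_›, not_le.1 ‹_›⟩ ⟨not_le.1 ‹_›, not_le.1 ‹_›⟩ htt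
    · intro t ht
      simp only
      split_ifs with h1 h2
      · exact ⟨by linarith, le_rfl⟩
      · exact ⟨le_rfl, by linarith⟩
      · exact Ioo_subset_Icc_self (hαm t ⟨not_le.1 h1, not_le.1 h2⟩)
    · intro t ht
      split_ifs with h1 h2
      · rw [hend, le_antisymm h1 ht.1]
      · rw [hθ₀, h01, le_antisymm ht.2 h2]
      · exact hrad t ht

end IsRadialBody

lemma eVariationOn_add_Icc {E : Type*} [PseudoEMetricSpace E] (f : ℝ → E) {a b c : ℝ}
    (hab : a ≤ b) (hbc : b ≤ c) :
    eVariationOn f (Icc a b) + eVariationOn f (Icc b c) = eVariationOn f (Icc a c) := by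
  simpa using eVariationOn.Icc_add_Icc f (s := univ) hab hbc (mem_univ b)

lemma Function.Periodic.eVariationOn_Icc_le {E : Type*} [PseudoEMetricSpace E] {f : ℝ → E}
    {T : ℝ} (hf : Function.Periodic f T) {a b : ℝ} (hba : b ≤ a) (hab : a ≤ b + T) :
    eVariationOn f (Icc a (a + T)) ≤ eVariationOn f (Icc b (b + T)) := by
  have h1 : eVariationOn f (Icc (b + T) (a + T)) ≤ eVariationOn f (Icc b a) := by
    have h2 : eVariationOn f (Icc (b + T) (a + T)) =
        eVariationOn (f ∘ fun x => x - T) (Icc (b + T) (a + T)) :=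
      eVariationOn.congr fun x _ => (hf.sub_eq x).symm
    rw [h2]
    refine eVariationOn.comp_le_of_monotoneOn f _ (fun x _ y _ h => sub_le_sub_right h T) ?_
    intro x hx
    exact ⟨by linarith [hx.1], by linarith [hx.2]⟩
  rw [← eVariationOn_add_Icc f hab (by linarith : b + T ≤ a + T), ← eVariationOn_add_Icc f hba hab,
    add_comm]
  gcongr

namespace IsNorm

variable {ρ : E2 → ℝ}

lemma map_zero (hρ : IsNorm ρ) : ρ 0 = 0 := (hρ.1 0).2 rfl

lemma map_smul_of_nonneg (hρ : IsNorm ρ) {c : ℝ} (hc : 0 ≤ c) (x : E2) :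
    ρ (c • x) = c * ρ x := by
  rw [hρ.2.1, abs_of_nonneg hc]

lemma map_neg (hρ : IsNorm ρ) (x : E2) : ρ (-x) = ρ x := by
  have := hρ.2.1 (-1) x
  simpa using this

lemma map_sub_rev (hρ : IsNorm ρ) (x y : E2) : ρ (x - y) = ρ (y - x) := by
  rw [← hρ.map_neg, neg_sub]

lemma nonneg (hρ : IsNorm ρ) (x : E2) : 0 ≤ ρ x := by
  have h := hρ.2.2 x (-x)
  rw [add_neg_cancel, hρ.map_zero, hρ.map_neg] at h
  linarith

lemma sub_le (hρ : IsNorm ρ) (x y z : E2) : ρ (x - z) ≤ ρ (x - y) + ρ (y - z) := by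
  have := hρ.2.2 (x - y) (y - z)
  rwa [sub_add_sub_cancel] at this

lemma exists_le_mul_norm (hρ : IsNorm ρ) : ∃ C, 0 ≤ C ∧ ∀ x, ρ x ≤ C * ‖x‖ := by
  refine ⟨ρ (EuclideanSpace.single 0 1) + ρ (EuclideanSpace.single 1 1),
    add_nonneg (hρ.nonneg _) (hρ.nonneg _), fun x => ?_⟩
  have hx : x = x 0 • EuclideanSpace.single 0 1 + x 1 • EuclideanSpace.single 1 1 := by
    ext i
    fin_cases i <;> simp
  have h := hρ.2.2 (x 0 • EuclideanSpace.single 0 1) (x 1 • EuclideanSpace.single 1 1)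
  rw [← hx, hρ.2.1, hρ.2.1] at h
  have h0 : |x 0| ≤ ‖x‖ := by simpa using PiLp.norm_apply_le x 0
  have h1 : |x 1| ≤ ‖x‖ := by simpa using PiLp.norm_apply_le x 1
  nlinarith [hρ.nonneg (EuclideanSpace.single 0 1), hρ.nonneg (EuclideanSpace.single 1 1)]

end IsNorm

/-- The plane with the distance induced by the norm `ρ`. -/
def RhoPlane (ρ : E2 → ℝ) (_ : IsNorm ρ) : Type := E2

instance (ρ : E2 → ℝ) (hρ : IsNorm ρ) : PseudoMetricSpace (RhoPlane ρ hρ) where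
  dist x y := ρ ((show E2 from x) - (show E2 from y))
  dist_self x := by
    rw [sub_self, hρ.map_zero]
  dist_comm x y := hρ.map_sub_rev _ _
  dist_triangle x y z := hρ.sub_le _ _ _

/-- The identity map onto the plane with the `ρ`-distance. -/
def toRho {ρ : E2 → ℝ} (hρ : IsNorm ρ) (x : E2) : RhoPlane ρ hρ := x

lemma edist_toRho {ρ : E2 → ℝ} (hρ : IsNorm ρ) (x y : E2) :
    edist (toRho hρ x) (toRho hρ y) = ENNReal.ofReal (ρ (x - y)) := by
  rw [edist_dist]
  rfl

/-- The `ρ`-variation of a curve. -/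
def rhoVariation {ρ : E2 → ℝ} (hρ : IsNorm ρ) (γ : ℝ → E2) (s : Set ℝ) : ENNReal :=
  eVariationOn (fun t => toRho hρ (γ t)) s

lemma ofReal_polygon_le {ρ : E2 → ℝ} (hρ : IsNorm ρ) (γ : ℝ → E2) {n : ℕ}
    {t : Fin (n + 1) → ℝ} (ht : StrictMono t) (h0 : t 0 = 0) (h1 : t (Fin.last n) = 1) :
    ENNReal.ofReal (∑ i : Fin n, ρ (γ (t i.succ) - γ (t i.castSucc))) ≤
      rhoVariation hρ γ (Icc 0 1) := by
  set u : ℕ → ℝ := fun k => t ⟨min k n, by omega⟩ with hu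
  have hmono : Monotone u := fun k l h => ht.monotone (Fin.mk_le_mk.2 (by omega))
  have hmem : ∀ k, u k ∈ Icc (0 : ℝ) 1 := fun k =>
    ⟨h0 ▸ ht.monotone (Fin.zero_le _), h1 ▸ ht.monotone (Fin.le_last _)⟩
  have h := eVariationOn.sum_le (f := fun s => toRho hρ (γ s)) (n := n) hmono hmem
  refine le_trans (le_of_eq ?_) h
  rw [ENNReal.ofReal_sum_of_nonneg fun i _ => hρ.nonneg _, Finset.sum_range]
  refine Finset.sum_congr rfl fun i _ => ?_
  have hs : u (i + 1) = t i.succ := by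
    simp only [hu]
    congr 1
    ext
    simp
  have hc : u i = t i.castSucc := by
    simp only [hu]
    congr 1
    ext
    simp only [Fin.val_castSucc]
    omega
  rw [edist_toRho, hs, hc]

lemma exists_polygon_extend {ρ : E2 → ℝ} (hρ : IsNorm ρ) (γ : ℝ → E2) {n : ℕ}
    {t : Fin (n + 1) → ℝ} (ht : StrictMono t) {q : ℝ} (hq : t (Fin.last n) ≤ q) :
    ∃ m, ∃ t' : Fin (m + 1) → ℝ, StrictMono t' ∧ t' 0 = t 0 ∧ t' (Fin.last m) = q ∧
      (∑ i : Fin n, ρ (γ (t i.succ) - γ (t i.castSucc))) + ρ (γ q - γ (t (Fin.last n))) ≤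
        ∑ i : Fin m, ρ (γ (t' i.succ) - γ (t' i.castSucc)) := by
  rcases hq.eq_or_lt with rfl | hlt
  · exact ⟨n, t, ht, rfl, rfl, by rw [sub_self, hρ.map_zero, add_zero]⟩
  · refine ⟨n + 1, Fin.snoc (α := fun _ => ℝ) t q, ?_, ?_, by simp, ?_⟩
    · rw [Fin.strictMono_iff_lt_succ]
      intro i
      refine Fin.lastCases ?_ (fun j => ?_) i
      · rw [Fin.succ_last, Fin.snoc_last, Fin.snoc_castSucc]
        exact hlt
      · rw [Fin.succ_castSucc, Fin.snoc_castSucc, Fin.snoc_castSucc]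
        exact ht (Fin.castSucc_lt_succ)
    · rw [← Fin.castSucc_zero, Fin.snoc_castSucc]
    · rw [Fin.sum_univ_castSucc]
      simp only [Fin.succ_castSucc, Fin.snoc_castSucc, Fin.succ_last, Fin.snoc_last]
      exact le_rfl

lemma toReal_rhoVariation_le_polyPerim {ρ : E2 → ℝ} (hρ : IsNorm ρ) {γ : ℝ → E2}
    (hfin : rhoVariation hρ γ (Icc 0 1) ≠ ⊤) :
    (rhoVariation hρ γ (Icc 0 1)).toReal ≤ polyPerim ρ γ := by
  set S : Set ℝ := {L | ∃ n : ℕ, ∃ t : Fin (n + 1) → ℝ, StrictMono t ∧ t 0 = 0 ∧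
    t (Fin.last n) = 1 ∧ L = ∑ i : Fin n, ρ (γ (t i.succ) - γ (t i.castSucc))} with hS
  have hbdd : BddAbove S := by
    refine ⟨(rhoVariation hρ γ (Icc 0 1)).toReal, ?_⟩
    rintro L ⟨n, t, ht, h0, h1, rfl⟩
    exact (ENNReal.ofReal_le_iff_le_toReal hfin).1 (ofReal_polygon_le hρ γ ht h0 h1)
  refine ENNReal.toReal_le_of_le_ofReal (Real.sSup_nonneg ?_) ?_
  · rintro L ⟨n, t, -, -, -, rfl⟩
    exact Finset.sum_nonneg fun i _ => hρ.nonneg _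
  refine iSup_le ?_
  rintro ⟨n, u, hu, hmem⟩
  have hind : ∀ k, ∃ m, ∃ t : Fin (m + 1) → ℝ, StrictMono t ∧ t 0 = 0 ∧
      t (Fin.last m) = u k ∧ (∑ i ∈ Finset.range k, ρ (γ (u (i + 1)) - γ (u i))) ≤
        ∑ i : Fin m, ρ (γ (t i.succ) - γ (t i.castSucc)) := by
    intro k
    induction k with
    | zero =>
      obtain ⟨m, t, ht, h0, h1, hs⟩ := exists_polygon_extend hρ γ (n := 0) (t := fun _ => 0)
        (fun i j h => by rw [Fin.lt_def] at h; omega) (q := u 0) (hmem 0).1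
      exact ⟨m, t, ht, h0, h1, by simpa using Finset.sum_nonneg fun i _ => hρ.nonneg _⟩
    | succ k ih =>
      obtain ⟨m, t, ht, h0, h1, hs⟩ := ih
      obtain ⟨m', t', ht', h0', h1', hs'⟩ := exists_polygon_extend hρ γ ht (q := u (k + 1))
        (h1 ▸ hu (Nat.le_succ k))
      refine ⟨m', t', ht', h0'.trans h0, h1', ?_⟩
      rw [Finset.sum_range_succ]
      rw [h1] at hs'
      linarith
  obtain ⟨m, t, ht, h0, h1, hs⟩ := hind n
  obtain ⟨m', t', ht', h0', h1', hs'⟩ := exists_polygon_extend hρ γ ht (q := 1)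
    (h1 ▸ (hmem n).2)
  simp only [edist_toRho]
  rw [← ENNReal.ofReal_sum_of_nonneg fun i _ => hρ.nonneg _]
  refine ENNReal.ofReal_le_ofReal ?_
  refine le_trans ?_ (le_csSup hbdd ⟨m', t', ht', h0'.trans h0, h1', rfl⟩)
  linarith [hρ.nonneg (γ 1 - γ (t (Fin.last m)))]

lemma polyPerim_le {ρ : E2 → ℝ} (hρ : IsNorm ρ) {γ : ℝ → E2} {B : ℝ} (hB : 0 ≤ B)
    (h : rhoVariation hρ γ (Icc 0 1) ≤ ENNReal.ofReal B) : polyPerim ρ γ ≤ B := by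
  refine Real.sSup_le ?_ hB
  rintro L ⟨n, t, ht, h0, h1, rfl⟩
  exact (ENNReal.ofReal_le_ofReal_iff hB).1 ((ofReal_polygon_le hρ γ ht h0 h1).trans h)

lemma setPerim_le {ρ : E2 → ℝ} (hρ : IsNorm ρ) {U : Set E2} {B : ℝ} (hB : 0 ≤ B)
    (h : ∀ γ, JordanParam U γ → rhoVariation hρ γ (Icc 0 1) ≤ ENNReal.ofReal B) :
    setPerim ρ U ≤ B := by
  refine Real.sSup_le ?_ hB
  rintro L ⟨γ, hγ, rfl⟩
  exact polyPerim_le hρ hB (h γ hγ)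

lemma toReal_rhoVariation_le_setPerim {ρ : E2 → ℝ} (hρ : IsNorm ρ) {U : Set E2} {B : ℝ}
    (hB : 0 ≤ B)
    (h : ∀ γ, JordanParam U γ → rhoVariation hρ γ (Icc 0 1) ≤ ENNReal.ofReal B)
    {γ : ℝ → E2} (hγ : JordanParam U γ) :
    (rhoVariation hρ γ (Icc 0 1)).toReal ≤ setPerim ρ U := by
  refine (toReal_rhoVariation_le_polyPerim hρ
    ((h γ hγ).trans_lt ENNReal.ofReal_lt_top).ne).trans (le_csSup ⟨B, ?_⟩ ⟨γ, hγ, rfl⟩)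
  rintro L ⟨δ, hδ, rfl⟩
  exact polyPerim_le hρ hB (h δ hδ)

/-- The set `U` in the affine coordinates `w ↦ o + T w`. -/
def pullback (o : E2) (T : ℂ ≃L[ℝ] E2) (U : Set E2) : Set ℂ := {w | o + T w ∈ U}

/-- The coordinates `w ↦ o + T w` as a homeomorphism. -/
def coordHomeo (o : E2) (T : ℂ ≃L[ℝ] E2) : ℂ ≃ₜ E2 :=
  T.toHomeomorph.trans (Homeomorph.addLeft o)

lemma coordHomeo_symm_apply (o : E2) (T : ℂ ≃L[ℝ] E2) (x : E2) :
    o + T ((coordHomeo o T).symm x) = x := (coordHomeo o T).apply_symm_apply x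

lemma mem_frontier_pullback {o : E2} {T : ℂ ≃L[ℝ] E2} {U : Set E2} {w : ℂ} :
    w ∈ frontier (pullback o T U) ↔ o + T w ∈ frontier U := by
  have := (coordHomeo o T).preimage_frontier U
  exact (Set.ext_iff.1 this w).symm

lemma isRadialBody_pullback {o : E2} (T : ℂ ≃L[ℝ] E2) {U : Set E2} (hUo : IsOpen U)
    (hUc : Convex ℝ U) (hUb : Bornology.IsBounded U) (ho : o ∈ U) :
    IsRadialBody (pullback o T U) where
  isOpen := hUo.preimage (coordHomeo o T).continuous
  convex := by
    intro x hx y hy a b ha hb hab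
    have := hUc hx hy ha hb hab
    change o + T (a • x + b • y) ∈ U
    convert this using 1
    have h1 : b = 1 - a := by linarith
    subst h1
    rw [map_add, map_smul, map_smul]
    module
  isBounded := by
    obtain ⟨R, hR⟩ := hUb.subset_closedBall 0
    rw [isBounded_iff_forall_norm_le]
    refine ⟨‖(T.symm : E2 →L[ℝ] ℂ)‖ * (R + ‖o‖), fun w hw => ?_⟩
    have h1 : ‖o + T w‖ ≤ R := by simpa using hR hw
    have h2 : ‖T w‖ ≤ R + ‖o‖ := by
      have := norm_sub_le (o + T w) o
      rw [add_sub_cancel_left] at this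
      linarith
    have h3 := (T.symm : E2 →L[ℝ] ℂ).le_opNorm (T w)
    simp only [ContinuousLinearEquiv.coe_coe, ContinuousLinearEquiv.symm_apply_apply] at h3
    exact h3.trans (by gcongr)
  zero_mem := by
    change o + T 0 ∈ U
    simpa using ho

/-- The boundary curve of `U` given by the radial parametrization in the coordinates `T`. -/
def radialCurve (o : E2) (T : ℂ ≃L[ℝ] E2) (U : Set E2) (θ : ℝ) : E2 :=
  o + T (radial (pullback o T U) θ)

lemma radialCurve_add_two_pi (o : E2) (T : ℂ ≃L[ℝ] E2) (U : Set E2) (θ : ℝ) :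
    radialCurve o T U (θ + 2 * Real.pi) = radialCurve o T U θ := by
  simp only [radialCurve, radial_add_two_pi]

lemma exists_lipschitzWith_toRho {ρ : E2 → ℝ} (hρ : IsNorm ρ) (o : E2) (T : ℂ ≃L[ℝ] E2) :
    ∃ C, LipschitzWith C fun w : ℂ => toRho hρ (o + T w) := by
  obtain ⟨C, hC, hCρ⟩ := hρ.exists_le_mul_norm
  refine ⟨⟨C * ‖(T : ℂ →L[ℝ] E2)‖, by positivity⟩, LipschitzWith.of_dist_le_mul fun x y => ?_⟩
  change ρ (o + T x - (o + T y)) ≤ C * ‖(T : ℂ →L[ℝ] E2)‖ * dist x y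
  rw [add_sub_add_left_eq_sub, ← map_sub, dist_eq_norm, mul_assoc]
  refine (hCρ _).trans ?_
  gcongr
  exact (T : ℂ →L[ℝ] E2).le_opNorm (x - y)

lemma rhoVariation_radialCurve_ne_top {ρ : E2 → ℝ} (hρ : IsNorm ρ) {o : E2} (T : ℂ ≃L[ℝ] E2)
    {U : Set E2} (hUo : IsOpen U) (hUc : Convex ℝ U) (hUb : Bornology.IsBounded U) (ho : o ∈ U)
    (a b : ℝ) :
    rhoVariation hρ (radialCurve o T U) (Icc a b) ≠ ⊤ := by
  obtain ⟨C, hC⟩ := exists_lipschitzWith_toRho hρ o T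
  obtain ⟨C', hC'⟩ := (isRadialBody_pullback T hUo hUc hUb ho).exists_lipschitzWith_radial
  have := (hC.comp hC').locallyBoundedVariationOn univ a b (mem_univ a) (mem_univ b)
  rw [univ_inter] at this
  exact this

lemma rhoVariation_le_radialCurve {ρ : E2 → ℝ} (hρ : IsNorm ρ) {o : E2} (T : ℂ ≃L[ℝ] E2)
    {U : Set E2} (hUo : IsOpen U) (hUc : Convex ℝ U) (hUb : Bornology.IsBounded U) (ho : o ∈ U)
    (a : ℝ) {γ : ℝ → E2} (hγ : JordanParam U γ) :
    rhoVariation hρ γ (Icc 0 1) ≤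
      rhoVariation hρ (radialCurve o T U) (Icc a (a + 2 * Real.pi)) := by
  have hK := isRadialBody_pullback T hUo hUc hUb ho
  obtain ⟨hc, h01, hi, him⟩ := hγ
  set δ : ℝ → ℂ := fun t => (coordHomeo o T).symm (γ t) with hδ
  have hδγ : ∀ t, o + T (δ t) = γ t := fun t => coordHomeo_symm_apply o T (γ t)
  have hfr : ∀ t ∈ Icc (0 : ℝ) 1, δ t ∈ frontier (pullback o T U) := fun t ht => by
    rw [mem_frontier_pullback, hδγ, ← him]
    exact mem_image_of_mem γ ht
  obtain ⟨θ₀, hθ₀, hr⟩ := hK.exists_radial_eq (hfr 0 ⟨le_rfl, zero_le_one⟩) a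
  have h1 := hK.eVariationOn_comp_le (fun w => toRho hρ (o + T w)) (δ := δ)
    ((coordHomeo o T).symm.continuous.comp_continuousOn hc) (congrArg (coordHomeo o T).symm h01)
    (fun t ht t' ht' h => hi ht ht' ((coordHomeo o T).symm.injective h)) hfr hr
  simp only [hδγ] at h1
  refine h1.trans ?_
  have hper : Function.Periodic (fun θ => toRho hρ (radialCurve o T U θ)) (2 * Real.pi) :=
    fun θ => by simp only [radialCurve_add_two_pi]
  exact hper.eVariationOn_Icc_le hθ₀.1 hθ₀.2.le

lemma jordanParam_radialCurve {o : E2} (T : ℂ ≃L[ℝ] E2)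
    {U : Set E2} (hUo : IsOpen U) (hUc : Convex ℝ U) (hUb : Bornology.IsBounded U) (ho : o ∈ U)
    (a : ℝ) :
    JordanParam U fun t => radialCurve o T U (a + 2 * Real.pi * t) := by
  have hK := isRadialBody_pullback T hUo hUc hUb ho
  have hpi := Real.pi_pos
  obtain ⟨C, hC⟩ := hK.exists_lipschitzWith_radial
  refine ⟨?_, ?_, ?_, ?_⟩
  · have h1 : Continuous fun t : ℝ => radial (pullback o T U) (a + 2 * Real.pi * t) :=
      hC.continuous.comp (by fun_prop)
    exact ((coordHomeo o T).continuous.comp h1).continuousOn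
  · simp only [mul_zero, add_zero, mul_one, radialCurve_add_two_pi]
  · intro t ht t' ht' h
    have h1 := (coordHomeo o T).injective h
    have h2 := hK.injOn_radial a
      ⟨by nlinarith [ht.1], by nlinarith [ht.2]⟩ ⟨by nlinarith [ht'.1], by nlinarith [ht'.2]⟩ h1
    have h3 : 2 * Real.pi * t = 2 * Real.pi * t' := by linarith
    exact mul_left_cancel₀ (by positivity) h3
  · refine Subset.antisymm ?_ fun x hx => ?_
    · rintro x ⟨t, -, rfl⟩
      exact mem_frontier_pullback.1 (hK.radial_mem_frontier _)
    · have hw : (coordHomeo o T).symm x ∈ frontier (pullback o T U) := by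
        rwa [mem_frontier_pullback, coordHomeo_symm_apply]
      obtain ⟨θ, hθ, hr⟩ := hK.exists_radial_eq hw a
      refine ⟨(θ - a) / (2 * Real.pi), ⟨?_, ?_⟩, ?_⟩
      · exact div_nonneg (by linarith [hθ.1]) (by positivity)
      · rw [div_le_one (by positivity)]
        linarith [hθ.2]
      · have : a + 2 * Real.pi * ((θ - a) / (2 * Real.pi)) = θ := by
          field_simp
          ring
        simp only [this]
        rw [radialCurve, hr, coordHomeo_symm_apply]

/-- The `ρ`-perimeter of a bounded open convex set is the `ρ`-variation of its radial boundary
curve. -/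
lemma setPerim_eq_toReal_rhoVariation {ρ : E2 → ℝ} (hρ : IsNorm ρ) {o : E2} (T : ℂ ≃L[ℝ] E2)
    {U : Set E2} (hUo : IsOpen U) (hUc : Convex ℝ U) (hUb : Bornology.IsBounded U) (ho : o ∈ U)
    (a : ℝ) : setPerim ρ U =
    (rhoVariation hρ (radialCurve o T U) (Icc a (a + 2 * Real.pi))).toReal := by
  have hfin := rhoVariation_radialCurve_ne_top hρ T hUo hUc hUb ho a (a + 2 * Real.pi)
  have hle : ∀ γ, JordanParam U γ → rhoVariation hρ γ (Icc 0 1) ≤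
      ENNReal.ofReal (rhoVariation hρ (radialCurve o T U) (Icc a (a + 2 * Real.pi))).toReal :=
    fun γ hγ => by
      rw [ENNReal.ofReal_toReal hfin]
      exact rhoVariation_le_radialCurve hρ T hUo hUc hUb ho a hγ
  refine le_antisymm (setPerim_le hρ ENNReal.toReal_nonneg hle) ?_
  have hJ := jordanParam_radialCurve T hUo hUc hUb ho a
  refine le_trans (ENNReal.toReal_mono ?_ ?_)
    (toReal_rhoVariation_le_setPerim hρ ENNReal.toReal_nonneg hle hJ)
  · exact ((hle _ hJ).trans_lt ENNReal.ofReal_lt_top).ne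
  · have hpi := Real.pi_pos
    have h1 : rhoVariation hρ (radialCurve o T U) (Icc a (a + 2 * Real.pi)) =
        eVariationOn ((fun t => toRho hρ (radialCurve o T U (a + 2 * Real.pi * t))) ∘
          fun θ => (θ - a) / (2 * Real.pi)) (Icc a (a + 2 * Real.pi)) := by
      refine eVariationOn.congr fun θ _ => ?_
      have : a + 2 * Real.pi * ((θ - a) / (2 * Real.pi)) = θ := by
        field_simp
        ring
      simp only [Function.comp, this]
    rw [h1]
    refine eVariationOn.comp_le_of_monotoneOn _ _ (fun x _ y _ h => ?_) fun x hx => ⟨?_, ?_⟩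
    · gcongr
    · exact div_nonneg (by linarith [hx.1]) (by positivity)
    · rw [div_le_one (by positivity)]
      linarith [hx.2]

lemma smul_unitDir_arctan (κ : ℝ) :
    (⟨1, κ⟩ : ℂ) = (Real.cos (Real.arctan κ))⁻¹ • unitDir (Real.arctan κ) := by
  have hc := Real.cos_arctan_pos κ
  have ht := Real.tan_arctan κ
  rw [Real.tan_eq_sin_div_cos] at ht
  apply Complex.ext
  · simp only [Complex.smul_re, unitDir_re, smul_eq_mul]
    rw [inv_mul_cancel₀ hc.ne']
  · simp only [Complex.smul_im, unitDir_im, smul_eq_mul]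
    rw [← div_eq_inv_mul, ht]

lemma cos_le_cos_pi_div_four {θ : ℝ} (h : θ ∈ Icc (Real.pi / 4) (7 * Real.pi / 4)) :
    Real.cos θ ≤ Real.cos (Real.pi / 4) := by
  have hpi := Real.pi_pos
  rcases le_total θ Real.pi with h1 | h1
  · exact Real.cos_le_cos_of_nonneg_of_le_pi (by linarith) h1 h.1
  · rw [← Real.cos_two_pi_sub θ]
    exact Real.cos_le_cos_of_nonneg_of_le_pi (by linarith) (by linarith) (by linarith [h.2])

/-- Cutting a convex body along the vertical chord from `1 - I` to `1 + I`. -/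
structure IsChordCut (K K' : Set ℂ) : Prop where
  radialBody : IsRadialBody K
  radialBody' : IsRadialBody K'
  mem_iff : ∀ w, w ∈ K' ↔ w ∈ K ∧ w.re < 1
  lower_mem : (⟨1, -1⟩ : ℂ) ∈ frontier K
  upper_mem : (⟨1, 1⟩ : ℂ) ∈ frontier K
  abs_im_le : ∀ w ∈ K, w.re = 1 → |w.im| ≤ 1
  mem_frontier : ∀ τ : ℝ, |τ| ≤ 1 → (⟨1, τ⟩ : ℂ) ∈ frontier K'

namespace IsChordCut

variable {K K' : Set ℂ}

lemma abs_im_div_re_lt (h : IsChordCut K K') {w : ℂ} (hw : w ∈ frontier K) (hre : 1 < w.re) :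
    |w.im / w.re| < 1 := by
  have hK := h.radialBody
  have hmem : (⟨1, w.im / w.re⟩ : ℂ) ∈ K := by
    have h1 := hK.convex.openSegment_interior_closure_subset_interior
      (by rw [hK.isOpen.interior_eq]; exact hK.zero_mem) (frontier_subset_closure hw)
    rw [hK.isOpen.interior_eq] at h1
    refine h1 ⟨1 - w.re⁻¹, w.re⁻¹, sub_pos.2 (inv_lt_one_of_one_lt₀ hre), by positivity,
      by ring, ?_⟩
    have : w.re ≠ 0 := by positivity
    apply Complex.ext
    · simp [this]
    · simp only [smul_zero, zero_add, Complex.smul_im, smul_eq_mul]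
      rw [div_eq_inv_mul]
  refine lt_of_le_of_ne (h.abs_im_le _ hmem rfl) fun heq => ?_
  have hnot : ∀ {x}, x ∈ frontier K → x ∉ K := fun hx => by
    rw [hK.isOpen.frontier_eq] at hx
    exact hx.2
  rcases eq_or_eq_neg_of_abs_eq heq with h2 | h2
  · rw [h2] at hmem
    exact hnot h.upper_mem hmem
  · rw [h2] at hmem
    exact hnot h.lower_mem hmem

lemma radial_eq_of_mem_Icc (h : IsChordCut K K') {θ : ℝ}
    (hθ : θ ∈ Icc (Real.pi / 4) (7 * Real.pi / 4)) : radial K' θ = radial K θ := by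
  have hK := h.radialBody
  set w := radial K θ with hw
  have hwf : w ∈ frontier K := hK.radial_mem_frontier θ
  have hg := hK.gauge_unitDir_pos θ
  set l := (gauge K (unitDir θ))⁻¹ with hl
  have hl0 : 0 < l := inv_pos.2 hg
  have hre : w.re = l * Real.cos θ := by
    rw [hw, radial, Complex.smul_re, unitDir_re, smul_eq_mul]
  have him : w.im = l * Real.sin θ := by
    rw [hw, radial, Complex.smul_im, unitDir_im, smul_eq_mul]
  refine h.radialBody'.radial_eq_of_mem_frontier ?_ hl0 rfl
  have hle : w.re ≤ 1 := by
    by_contra! hgt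
    have h1 := h.abs_im_div_re_lt hwf hgt
    have hcos : 0 < Real.cos θ := by
      by_contra! hc
      nlinarith
    rw [hre, him, mul_div_mul_left _ _ hl0.ne', abs_div, abs_of_pos hcos, div_lt_one hcos] at h1
    have h2 : Real.sin θ ^ 2 < Real.cos θ ^ 2 := by
      rw [← sq_abs (Real.sin θ)]
      gcongr
    have h3 := cos_le_cos_pi_div_four hθ
    rw [Real.cos_pi_div_four] at h3
    have h4 : Real.cos θ ^ 2 ≤ (√2 / 2) ^ 2 := by gcongr
    rw [div_pow, Real.sq_sqrt (by norm_num)] at h4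
    nlinarith [Real.sin_sq_add_cos_sq θ]
  have hsub : openSegment ℝ 0 w ⊆ K' := by
    have h1 := hK.convex.openSegment_interior_closure_subset_interior
      (by rw [hK.isOpen.interior_eq]; exact hK.zero_mem) (frontier_subset_closure hwf)
    rw [hK.isOpen.interior_eq] at h1
    intro y hy
    refine (h.mem_iff y).2 ⟨h1 hy, ?_⟩
    obtain ⟨a, b, ha, hb, hab, rfl⟩ := hy
    simp only [smul_zero, zero_add, Complex.smul_re, smul_eq_mul]
    nlinarith
  rw [h.radialBody'.isOpen.frontier_eq]
  refine ⟨closure_mono hsub ?_, fun hmem => ?_⟩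
  · rw [closure_openSegment]
    exact right_mem_segment ℝ _ _
  · rw [hK.isOpen.frontier_eq] at hwf
    exact hwf.2 ((h.mem_iff w).1 hmem).1

lemma radial_eq_of_mem_Icc_neg (h : IsChordCut K K') {θ : ℝ}
    (hθ : θ ∈ Icc (-(Real.pi / 4)) (Real.pi / 4)) : radial K' θ = ⟨1, Real.tan θ⟩ := by
  have hpi := Real.pi_pos
  have hat : Real.arctan (Real.tan θ) = θ :=
    Real.arctan_tan (by linarith [hθ.1]) (by linarith [hθ.2])
  have h1 := smul_unitDir_arctan (Real.tan θ)
  rw [hat] at h1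
  refine h.radialBody'.radial_eq_of_mem_frontier (h.mem_frontier _ ?_)
    (inv_pos.2 (Real.cos_pos_of_mem_Ioo ⟨by linarith [hθ.1], by linarith [hθ.2]⟩)) h1
  have hm : MonotoneOn Real.tan (Ioo (-(Real.pi / 2)) (Real.pi / 2)) :=
    Real.strictMonoOn_tan.monotoneOn
  have hI : ∀ {x}, x ∈ Icc (-(Real.pi / 4)) (Real.pi / 4) →
      x ∈ Ioo (-(Real.pi / 2)) (Real.pi / 2) := fun hx =>
    ⟨by linarith [hx.1], by linarith [hx.2]⟩
  have h2 := hm (hI ⟨le_rfl, by linarith⟩) (hI hθ) hθ.1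
  have h3 := hm (hI hθ) (hI ⟨by linarith, le_rfl⟩) hθ.2
  rw [Real.tan_neg, Real.tan_pi_div_four] at h2
  rw [Real.tan_pi_div_four] at h3
  exact abs_le.2 ⟨h2, h3⟩

lemma radial_arctan (h : IsChordCut K K') {w : ℂ} (hw : w ∈ frontier K) (hre : 0 < w.re) :
    radial K (Real.arctan (w.im / w.re)) = w := by
  refine h.radialBody.radial_eq_of_mem_frontier hw
    (mul_pos hre (inv_pos.2 (Real.cos_arctan_pos (w.im / w.re)))) ?_
  rw [mul_smul, ← smul_unitDir_arctan]
  apply Complex.ext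
  · simp
  · simp only [Complex.smul_im, smul_eq_mul]
    field_simp

end IsChordCut

/-- The linear coordinates on the plane given by two linearly independent vectors. -/
lemma exists_coordinates {e₁ e₂ : E2}
    (h : ∀ p q : ℝ, p • e₁ + q • e₂ = 0 → p = 0 ∧ q = 0) :
    ∃ T : ℂ ≃L[ℝ] E2, ∀ w : ℂ, T w = w.re • e₁ + w.im • e₂ := by
  let L : ℂ →ₗ[ℝ] E2 :=
    { toFun := fun w => w.re • e₁ + w.im • e₂
      map_add' := fun x y => by
        simp only [Complex.add_re, Complex.add_im]
        module
      map_smul' := fun c x => by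
        simp only [Complex.smul_re, Complex.smul_im, RingHom.id_apply, smul_eq_mul]
        module }
  have hinj : Function.Injective L := by
    rw [← LinearMap.ker_eq_bot, LinearMap.ker_eq_bot']
    intro w hw
    obtain ⟨h1, h2⟩ := h _ _ hw
    exact Complex.ext h1 h2
  have hrank : Module.finrank ℝ ℂ = Module.finrank ℝ E2 := by
    rw [Complex.finrank_real_complex, finrank_euclideanSpace, Fintype.card_fin]
  exact ⟨(LinearEquiv.ofInjectiveOfFinrankEq L hinj hrank).toContinuousLinearEquiv, fun w => rfl⟩

namespace IsChordCut

variable {U V : Set E2} {o : E2} {T : ℂ ≃L[ℝ] E2}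

lemma rhoVariation_chord_le {ρ : E2 → ℝ} (hρ : IsNorm ρ)
    (h : IsChordCut (pullback o T U) (pullback o T V)) :
    rhoVariation hρ (radialCurve o T V) (Icc (-(Real.pi / 4)) (Real.pi / 4)) ≤
      ENNReal.ofReal (ρ (T ⟨1, 1⟩ - T ⟨1, -1⟩)) := by
  have hpi := Real.pi_pos
  have hcongr : rhoVariation hρ (radialCurve o T V) (Icc (-(Real.pi / 4)) (Real.pi / 4)) =
      eVariationOn ((fun τ : ℝ => toRho hρ (o + T ⟨1, τ⟩)) ∘ Real.tan)
        (Icc (-(Real.pi / 4)) (Real.pi / 4)) := by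
    refine eVariationOn.congr fun θ hθ => ?_
    simp only [Function.comp, radialCurve, h.radial_eq_of_mem_Icc_neg hθ]
  have hmem : ∀ {x}, x ∈ Icc (-(Real.pi / 4)) (Real.pi / 4) →
      x ∈ Ioo (-(Real.pi / 2)) (Real.pi / 2) := fun hx =>
    ⟨by linarith [hx.1], by linarith [hx.2]⟩
  have hmono : MonotoneOn Real.tan (Icc (-(Real.pi / 4)) (Real.pi / 4)) := fun x hx y hy hxy =>
    Real.strictMonoOn_tan.monotoneOn (hmem hx) (hmem hy) hxy
  set e := T ⟨0, 1⟩ with he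
  have hdiff : ∀ τ τ' : ℝ, T ⟨1, τ⟩ - T ⟨1, τ'⟩ = (τ - τ') • e := fun τ τ' => by
    rw [he, ← map_sub, ← map_smul]
    congr 1
    apply Complex.ext <;> simp
  have hlip : LipschitzWith ⟨ρ e, hρ.nonneg e⟩ fun τ : ℝ => toRho hρ (o + T ⟨1, τ⟩) := by
    refine LipschitzWith.of_dist_le_mul fun x y => ?_
    change ρ (o + T ⟨1, x⟩ - (o + T ⟨1, y⟩)) ≤ ρ e * dist x y
    rw [add_sub_add_left_eq_sub, hdiff, hρ.2.1, Real.dist_eq, mul_comm]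
  rw [hcongr]
  refine ((hlip.lipschitzOnWith (s := univ)).comp_eVariationOn_le fun _ _ => mem_univ _).trans ?_
  have h1 := hmono.eVariationOn_eq (a := -(Real.pi / 4)) (b := Real.pi / 4)
    ⟨le_rfl, by linarith⟩ ⟨by linarith, le_rfl⟩
  rw [inter_self, Real.tan_neg, Real.tan_pi_div_four] at h1
  refine (mul_le_mul_right h1.le _).trans (le_of_eq ?_)
  rw [hdiff, hρ.2.1, ENNReal.ofReal_mul (abs_nonneg _), mul_comm, abs_of_nonneg (by norm_num)]
  congr 1
  rw [ENNReal.ofReal_eq_coe_nnreal (hρ.nonneg e)]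
  rfl

lemma le_rhoVariation {ρ : E2 → ℝ} (hρ : IsNorm ρ)
    (h : IsChordCut (pullback o T U) (pullback o T V)) {w : ℂ}
    (hw : w ∈ frontier (pullback o T U)) (hre : 1 < w.re) :
    ENNReal.ofReal (ρ (T w - T ⟨1, -1⟩)) + ENNReal.ofReal (ρ (T ⟨1, 1⟩ - T w)) ≤
      rhoVariation hρ (radialCurve o T U) (Icc (-(Real.pi / 4)) (Real.pi / 4)) := by
  have habs := abs_lt.1 (h.abs_im_div_re_lt hw hre)
  set φ := Real.arctan (w.im / w.re) with hφ
  have h1 : -(Real.pi / 4) ≤ φ := by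
    rw [← Real.arctan_one, ← Real.arctan_neg]
    exact Real.arctan_strictMono.monotone habs.1.le
  have h2 : φ ≤ Real.pi / 4 := by
    rw [← Real.arctan_one]
    exact Real.arctan_strictMono.monotone habs.2.le
  have hrw : radial (pullback o T U) φ = w := h.radial_arctan hw (by linarith)
  have hlow : radial (pullback o T U) (-(Real.pi / 4)) = ⟨1, -1⟩ := by
    have := h.radial_arctan h.lower_mem (by norm_num)
    simpa [Real.arctan_neg, Real.arctan_one] using this
  have hupp : radial (pullback o T U) (Real.pi / 4) = ⟨1, 1⟩ := by
    have := h.radial_arctan h.upper_mem (by norm_num)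
    simpa [Real.arctan_one] using this
  rw [rhoVariation, ← eVariationOn_add_Icc _ h1 h2]
  refine add_le_add ?_ ?_
  · have := eVariationOn.edist_le (fun t => toRho hρ (radialCurve o T U t))
      (s := Icc (-(Real.pi / 4)) φ) (right_mem_Icc.2 h1) (left_mem_Icc.2 h1)
    rwa [edist_toRho, radialCurve, radialCurve, hrw, hlow, add_sub_add_left_eq_sub] at this
  · have := eVariationOn.edist_le (fun t => toRho hρ (radialCurve o T U t))
      (s := Icc φ (Real.pi / 4)) (right_mem_Icc.2 h2) (left_mem_Icc.2 h2)
    rwa [edist_toRho, radialCurve, radialCurve, hrw, hupp, add_sub_add_left_eq_sub] at this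

lemma setPerim_add_le {ρ : E2 → ℝ} (hρ : IsNorm ρ) (hUo : IsOpen U) (hUc : Convex ℝ U)
    (hUb : Bornology.IsBounded U) (hVo : IsOpen V) (hVc : Convex ℝ V)
    (hVU : V ⊆ U) (ho : o ∈ V)
    (h : IsChordCut (pullback o T U) (pullback o T V)) {w : ℂ}
    (hw : w ∈ frontier (pullback o T U)) (hre : 1 < w.re) :
    setPerim ρ V + (ρ (T w - T ⟨1, -1⟩) + ρ (T ⟨1, 1⟩ - T w) - ρ (T ⟨1, 1⟩ - T ⟨1, -1⟩)) ≤
      setPerim ρ U := by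
  have hpi := Real.pi_pos
  have hVb := hUb.subset hVU
  rw [setPerim_eq_toReal_rhoVariation hρ T hUo hUc hUb (hVU ho) (-(Real.pi / 4)),
    setPerim_eq_toReal_rhoVariation hρ T hVo hVc hVb ho (-(Real.pi / 4))]
  have hend : -(Real.pi / 4) + 2 * Real.pi = 7 * Real.pi / 4 := by ring
  rw [hend]
  have hsplit : ∀ W, rhoVariation hρ (radialCurve o T W) (Icc (-(Real.pi / 4)) (7 * Real.pi / 4)) =
      rhoVariation hρ (radialCurve o T W) (Icc (-(Real.pi / 4)) (Real.pi / 4)) +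
      rhoVariation hρ (radialCurve o T W) (Icc (Real.pi / 4) (7 * Real.pi / 4)) := fun W =>
    (eVariationOn_add_Icc _ (by linarith) (by linarith)).symm
  have hU := rhoVariation_radialCurve_ne_top hρ T hUo hUc hUb (hVU ho)
  have hV := rhoVariation_radialCurve_ne_top hρ T hVo hVc hVb ho
  have hfar : rhoVariation hρ (radialCurve o T V) (Icc (Real.pi / 4) (7 * Real.pi / 4)) =
      rhoVariation hρ (radialCurve o T U) (Icc (Real.pi / 4) (7 * Real.pi / 4)) :=
    eVariationOn.congr fun θ hθ => by simp only [radialCurve, h.radial_eq_of_mem_Icc hθ]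
  rw [hsplit U, hsplit V, ENNReal.toReal_add (hU _ _) (hU _ _),
    ENNReal.toReal_add (hV _ _) (hV _ _), hfar]
  have h1 := ENNReal.toReal_le_of_le_ofReal (hρ.nonneg _) (h.rhoVariation_chord_le hρ)
  have h2 := h.le_rhoVariation hρ hw hre
  rw [← ENNReal.ofReal_add (hρ.nonneg _) (hρ.nonneg _)] at h2
  have h3 := (ENNReal.ofReal_le_iff_le_toReal (hU _ _)).1 h2
  linarith

end IsChordCut

/-- Cutting a convex set along a chord decreases the `ρ`-perimeter at least by the excess in the
triangle inequality for any boundary point that is cut off. -/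
lemma setPerim_add_le_of_chord {ρ : E2 → ℝ} (hρ : IsNorm ρ) {U V : Set E2} (hUo : IsOpen U)
    (hUc : Convex ℝ U) (hUb : Bornology.IsBounded U) (hVo : IsOpen V) (hVc : Convex ℝ V)
    (hVne : V.Nonempty) {P Q x₀ : E2} {f : E2 →L[ℝ] ℝ} (hf : f P = f Q) (hfx : f P < f x₀)
    (hV : V = {x | x ∈ U ∧ f x < f P}) (hseg : ∀ x ∈ U, f x = f P → x ∈ segment ℝ P Q)
    (hPQ : P ≠ Q) (hP : P ∈ frontier U) (hQ : Q ∈ frontier U) (hx₀ : x₀ ∈ frontier U)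
    (hfr : segment ℝ P Q ⊆ frontier V) :
    setPerim ρ V + (ρ (x₀ - P) + ρ (Q - x₀) - ρ (Q - P)) ≤ setPerim ρ U := by
  obtain ⟨o, ho⟩ := hVne
  have hVU : V ⊆ U := by
    rw [hV]
    exact fun x hx => hx.1
  have hfo : f o < f P := by
    rw [hV] at ho
    exact ho.2
  set e₁ : E2 := (1 / 2 : ℝ) • (P + Q) - o with he₁
  set e₂ : E2 := (1 / 2 : ℝ) • (Q - P) with he₂
  have hfe₁ : f e₁ = f P - f o := by
    rw [he₁, map_sub, map_smul, map_add, ← hf, smul_eq_mul]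
    ring
  have hfe₂ : f e₂ = 0 := by
    rw [he₂, map_smul, map_sub, ← hf, sub_self, smul_zero]
  have he₂ne : e₂ ≠ 0 := smul_ne_zero (by norm_num) (sub_ne_zero.2 hPQ.symm)
  obtain ⟨T, hT⟩ := exists_coordinates (e₁ := e₁) (e₂ := e₂) fun p q hpq => by
    have h1 := congrArg f hpq
    rw [map_add, map_smul, map_smul, hfe₁, hfe₂, smul_zero, add_zero, map_zero, smul_eq_mul] at h1
    have hp : p = 0 := (mul_eq_zero.1 h1).resolve_right (by linarith)
    rw [hp, zero_smul, zero_add] at hpq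
    exact ⟨hp, (smul_eq_zero.1 hpq).resolve_right he₂ne⟩
  have hfT : ∀ w : ℂ, f (o + T w) = f o + w.re * (f P - f o) := fun w => by
    rw [hT, map_add, map_add, map_smul, map_smul, hfe₁, hfe₂, smul_zero, add_zero, smul_eq_mul]
  have hline : ∀ τ : ℝ, o + T ⟨1, τ⟩ = ((1 - τ) / 2) • P + ((1 + τ) / 2) • Q := fun τ => by
    rw [hT, he₁, he₂]
    module
  have hlow : o + T ⟨1, -1⟩ = P := by
    rw [hline]
    norm_num
  have hupp : o + T ⟨1, 1⟩ = Q := by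
    rw [hline]
    norm_num
  have hcut : IsChordCut (pullback o T U) (pullback o T V) :=
    { radialBody := isRadialBody_pullback T hUo hUc hUb (hVU ho)
      radialBody' := isRadialBody_pullback T hVo hVc (hUb.subset hVU) ho
      mem_iff := fun w => by
        change o + T w ∈ V ↔ o + T w ∈ U ∧ _
        rw [hV]
        change _ ∧ f (o + T w) < f P ↔ _
        rw [hfT]
        refine and_congr_right fun _ => ⟨fun h => ?_, fun h => ?_⟩
        · by_contra! h'
          nlinarith
        · nlinarith
      lower_mem := by rwa [mem_frontier_pullback, hlow]
      upper_mem := by rwa [mem_frontier_pullback, hupp]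
      abs_im_le := fun w hw hre => by
        have hmem := hseg (o + T w) hw (by rw [hfT, hre]; ring)
        obtain ⟨p, q, hp, hq, hpq, hx⟩ := hmem
        have h1 : o + T ⟨1, q - p⟩ = o + T w := by
          rw [← hx, hline]
          have hp' : (1 - (q - p)) / 2 = p := by linarith
          have hq' : (1 + (q - p)) / 2 = q := by linarith
          rw [hp', hq']
        have h2 := T.injective (add_left_cancel h1)
        rw [← h2]
        exact abs_le.2 ⟨by simp only; linarith, by simp only; linarith⟩
      mem_frontier := fun τ hτ => by
        rw [mem_frontier_pullback, hline]
        have := abs_le.1 hτ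
        exact hfr ⟨(1 - τ) / 2, (1 + τ) / 2, by linarith, by linarith, by ring, rfl⟩ }
  set w := (coordHomeo o T).symm x₀ with hw
  have hwx : o + T w = x₀ := coordHomeo_symm_apply o T x₀
  have hwf : w ∈ frontier (pullback o T U) := by rwa [mem_frontier_pullback, hwx]
  have hre : 1 < w.re := by
    have h1 := hfT w
    rw [hwx] at h1
    by_contra! h'
    nlinarith
  have := hcut.setPerim_add_le hρ hUo hUc hUb hVo hVc hVU ho hwf hre
  rwa [← add_sub_add_left_eq_sub (T w) _ o, ← add_sub_add_left_eq_sub (T ⟨1, 1⟩) (T w) o,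
    ← add_sub_add_left_eq_sub (T ⟨1, 1⟩) (T ⟨1, -1⟩) o, hwx, hlow, hupp] at this

lemma exists_basis_bounds {A B : E2} (h : ∀ p q : ℝ, p • A + q • B = 0 → p = 0 ∧ q = 0) :
    ∃ M > 0, (∀ x, ∃ p q : ℝ, x = p • A + q • B) ∧
      (∀ p q : ℝ, |p| + |q| ≤ M * ‖p • A + q • B‖) ∧
      ∀ f : E2 →L[ℝ] ℝ, ‖f‖ ≤ M * (|f A| + |f B|) := by
  obtain ⟨T, hT⟩ := exists_coordinates h
  set M := 2 * ‖(T.symm : E2 →L[ℝ] ℂ)‖ + 1 with hM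
  have hM0 : 0 < M := by positivity
  have hspan : ∀ x, ∃ p q : ℝ, x = p • A + q • B := fun x =>
    ⟨(T.symm x).re, (T.symm x).im, by rw [← hT, T.apply_symm_apply]⟩
  have hbound : ∀ p q : ℝ, |p| + |q| ≤ M * ‖p • A + q • B‖ := fun p q => by
    have h1 := (T.symm : E2 →L[ℝ] ℂ).le_opNorm (T ⟨p, q⟩)
    simp only [ContinuousLinearEquiv.coe_coe, ContinuousLinearEquiv.symm_apply_apply] at h1
    rw [hT] at h1
    have h2 := Complex.abs_re_le_norm ⟨p, q⟩
    have h3 := Complex.abs_im_le_norm ⟨p, q⟩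
    simp only at h1 h2 h3
    nlinarith [norm_nonneg (p • A + q • B)]
  refine ⟨M, hM0, hspan, hbound, fun f => f.opNorm_le_bound (by positivity) fun x => ?_⟩
  obtain ⟨p, q, rfl⟩ := hspan x
  have h1 := hbound p q
  rw [map_add, map_smul, map_smul, smul_eq_mul, smul_eq_mul, Real.norm_eq_abs]
  calc |p * f A + q * f B| ≤ |p| * |f A| + |q| * |f B| := by
        rw [← abs_mul, ← abs_mul]
        exact abs_add_le _ _
    _ ≤ (|p| + |q|) * (|f A| + |f B|) := by
        nlinarith [abs_nonneg p, abs_nonneg q, abs_nonneg (f A), abs_nonneg (f B)]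
    _ ≤ M * ‖p • A + q • B‖ * (|f A| + |f B|) := by gcongr
    _ = M * (|f A| + |f B|) * ‖p • A + q • B‖ := by ring

/-- A unit functional supporting an open convex set at an exterior or boundary point. -/
lemma exists_supporting_functional {U : Set E2} (hUo : IsOpen U) (hUc : Convex ℝ U)
    (hne : U.Nonempty) {z : E2} (hz : z ∉ U) :
    ∃ f : E2 →L[ℝ] ℝ, ‖f‖ = 1 ∧ (∀ x ∈ U, f x < f z) ∧ ∀ x ∈ closure U, f x ≤ f z := by
  obtain ⟨g, hg⟩ := geometric_hahn_banach_open_point hUc hUo hz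
  have hg0 : g ≠ 0 := by
    rintro rfl
    obtain ⟨x, hx⟩ := hne
    simpa using hg x hx
  have hn : 0 < ‖g‖ := norm_pos_iff.2 hg0
  have hlt : ∀ x ∈ U, (‖g‖⁻¹ • g) x < (‖g‖⁻¹ • g) z := fun x hx =>
    mul_lt_mul_of_pos_left (hg x hx) (inv_pos.2 hn)
  refine ⟨‖g‖⁻¹ • g, ?_, hlt, fun x hx => ?_⟩
  · rw [norm_smul, norm_inv, norm_norm, inv_mul_cancel₀ hn.ne']
  · exact closure_minimal (fun y hy => (hlt y hy).le)
      (isClosed_le (‖g‖⁻¹ • g).continuous continuous_const) hx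

lemma abs_map_sub_le {f : E2 →L[ℝ] ℝ} {x y : E2} {r : ℝ} (h : ‖x - y‖ ≤ r) :
    |f x - f y| ≤ ‖f‖ * r := by
  rw [← map_sub, ← Real.norm_eq_abs]
  exact (f.le_opNorm _).trans (by gcongr)

/-- A convex set lies in the cone spanned by the two tangent directions at a corner. -/
lemma nonneg_of_mem_closure_of_corner {U : Set E2} (hUo : IsOpen U) (hUc : Convex ℝ U)
    (hne : U.Nonempty) {x₀ A B : E2} (hx₀ : x₀ ∈ frontier U)
    (hAB : ∀ p q : ℝ, p • A + q • B = 0 → p = 0 ∧ q = 0) {P Q : ℝ → E2}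
    (hPf : ∀ s, P s ∈ frontier U) (hQf : ∀ s, Q s ∈ frontier U)
    (hP : ∀ ε > 0, ∀ᶠ s in nhdsWithin (0 : ℝ) (Ioi 0), ‖P s - x₀ - s • A‖ ≤ ε * s)
    (hQ : ∀ ε > 0, ∀ᶠ s in nhdsWithin (0 : ℝ) (Ioi 0), ‖Q s - x₀ - s • B‖ ≤ ε * s)
    {p q : ℝ} (hy : x₀ + (p • A + q • B) ∈ closure U) : 0 ≤ p := by
  by_contra! hp
  obtain ⟨M, hM, -, -, hfM⟩ := exists_basis_bounds hAB
  set D := 8 + (4 + 3 * |q|) / (-p) with hD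
  have hp' : 0 < -p := by linarith
  have hD0 : 0 < D := by positivity
  set ε := 1 / (2 * M * D) with hε
  have hε0 : 0 < ε := by positivity
  have hdouble : Tendsto (fun s : ℝ => 2 * s) (nhdsWithin 0 (Ioi 0)) (nhdsWithin 0 (Ioi 0)) := by
    refine tendsto_nhdsWithin_iff.2 ⟨?_, ?_⟩
    · have : Tendsto (fun s : ℝ => 2 * s) (nhds 0) (nhds (2 * 0)) := by
        exact (continuous_const.mul continuous_id).tendsto 0
      rw [mul_zero] at this
      exact this.mono_left nhdsWithin_le_nhds
    · filter_upwards [self_mem_nhdsWithin] with s hs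
      exact mul_pos two_pos (mem_Ioi.1 hs)
  have hunit : ∀ᶠ s in nhdsWithin (0 : ℝ) (Ioi 0), s ∈ Ioo (0 : ℝ) 1 :=
    Ioo_mem_nhdsGT zero_lt_one
  obtain ⟨σ, hPσ, hQσ, hQσ2, hσ1⟩ := ((hP ε hε0).and ((hQ ε hε0).and
    ((hdouble.eventually (hQ ε hε0)).and hunit))).exists
  have hσ0 : 0 < σ := hσ1.1
  have hnot : Q σ ∉ U := by
    have := hQf σ
    rw [hUo.frontier_eq] at this
    exact this.2
  obtain ⟨f, hf1, -, hf⟩ := exists_supporting_functional hUo hUc hne hnot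
  have e1 := abs_le.1 (abs_map_sub_le (f := f) hPσ)
  have e2 := abs_le.1 (abs_map_sub_le (f := f) hQσ)
  have e3 := abs_le.1 (abs_map_sub_le (f := f) hQσ2)
  have i1 := hf x₀ (frontier_subset_closure hx₀)
  have i2 := hf _ (frontier_subset_closure (hQf (2 * σ)))
  have i3 := hf _ (frontier_subset_closure (hPf σ))
  have i4 := hf _ hy
  simp only [map_sub, map_add, map_smul, smul_eq_mul, hf1, one_mul] at e1 e2 e3 i4
  have b1 : -ε ≤ f B := by
    by_contra! h'
    nlinarith
  have b2 : f B ≤ 3 * ε := by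
    by_contra! h'
    nlinarith
  have b3 : f A ≤ 5 * ε := by
    by_contra! h'
    nlinarith
  have hBabs : |f B| ≤ 3 * ε := abs_le.2 ⟨by linarith, b2⟩
  have b4 : (-p) * (-f A) ≤ (4 + 3 * |q|) * ε := by
    have h1 : -(q * f B) ≤ |q| * (3 * ε) := by
      calc -(q * f B) ≤ |q * f B| := neg_le_abs _
        _ = |q| * |f B| := abs_mul _ _
        _ ≤ |q| * (3 * ε) := by gcongr
    have h2 : σ * f B + ε * σ ≤ 4 * ε := by
      have := hσ1.2
      nlinarith
    linarith
  have b5 : -f A ≤ (4 + 3 * |q|) / (-p) * ε := by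
    rw [div_mul_eq_mul_div, le_div_iff₀ hp']
    linarith
  have hAabs : |f A| ≤ (5 + (4 + 3 * |q|) / (-p)) * ε := by
    have : 0 ≤ (4 + 3 * |q|) / (-p) * ε := by positivity
    exact abs_le.2 ⟨by linarith, by linarith⟩
  have hfin := hfM f
  rw [hf1] at hfin
  have : M * (|f A| + |f B|) ≤ M * (D * ε) := by
    gcongr
    rw [hD]
    linarith
  have hhalf : M * (D * ε) = 1 / 2 := by
    rw [hε]
    field_simp
  linarith

lemma chord_nondegenerate {x₀ A B P Q : E2} {M ε s : ℝ} (hM : 0 < M)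
    (hbound : ∀ p q : ℝ, |p| + |q| ≤ M * ‖p • A + q • B‖) (hs : 0 < s) (hε : 8 * (M * ε) ≤ 1)
    (hP : ‖P - x₀ - s • A‖ ≤ ε * s) (hQ : ‖Q - x₀ - s • B‖ ≤ ε * s) :
    P ≠ Q ∧ x₀ ∉ segment ℝ P Q := by
  constructor
  · rintro rfl
    have h1 := hbound s (-s)
    have h2 : s • A + (-s) • B = (P - x₀ - s • B) - (P - x₀ - s • A) := by module
    have h3 := norm_sub_le (P - x₀ - s • B) (P - x₀ - s • A)
    rw [← h2] at h3
    rw [abs_neg, abs_of_pos hs] at h1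
    have h4 : M * ‖s • A + (-s) • B‖ ≤ M * (2 * (ε * s)) := by
      gcongr
      linarith
    nlinarith
  · rintro ⟨α, β, hα, hβ, hαβ, hx⟩
    have h1 := hbound (α * s) (β * s)
    have h2 : (α * s) • A + (β * s) • B =
        -(α • (P - x₀ - s • A) + β • (Q - x₀ - s • B)) := by
      have : (α • (P - x₀ - s • A) + β • (Q - x₀ - s • B)) =
          (α • P + β • Q) - (α + β) • x₀ - ((α * s) • A + (β * s) • B) := by module
      rw [this, hx, hαβ, one_smul]
      abel
    have h3 : ‖(α * s) • A + (β * s) • B‖ ≤ ε * s := by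
      rw [h2, norm_neg]
      refine (norm_add_le _ _).trans ?_
      rw [norm_smul, norm_smul, Real.norm_of_nonneg hα, Real.norm_of_nonneg hβ]
      calc α * ‖P - x₀ - s • A‖ + β * ‖Q - x₀ - s • B‖ ≤ α * (ε * s) + β * (ε * s) := by gcongr
        _ = ε * s := by rw [← add_mul, hαβ, one_mul]
    rw [abs_of_nonneg (by positivity), abs_of_nonneg (by positivity), ← add_mul, hαβ] at h1
    have h4 : M * ‖(α * s) • A + (β * s) • B‖ ≤ M * (ε * s) := by gcongr
    nlinarith

/-- Points of the tangent cone above the chord are at distance of order `s` from the corner. -/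
lemma norm_sub_le_of_cap {x₀ A B P Q : E2} {M ε s : ℝ}
    (hfM : ∀ f : E2 →L[ℝ] ℝ, ‖f‖ ≤ M * (|f A| + |f B|)) (hs : 0 < s) (hε0 : 0 < ε)
    (hε : 8 * (M * ε) ≤ 1)
    (hP : ‖P - x₀ - s • A‖ ≤ ε * s) (hQ : ‖Q - x₀ - s • B‖ ≤ ε * s) {f : E2 →L[ℝ] ℝ}
    (hf : f P = f Q) (hfx : f P < f x₀) {p q : ℝ} (hp : 0 ≤ p) (hq : 0 ≤ q)
    (hy : f P ≤ f (x₀ + (p • A + q • B))) :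
    ‖x₀ + (p • A + q • B) - x₀‖ ≤ 2 * (‖A‖ + ‖B‖) * s := by
  set d := f x₀ - f P with hd
  have hd0 : 0 < d := sub_pos.2 hfx
  set N := s * (|f A| + |f B|) with hN
  have hN0 : 0 ≤ N := by positivity
  have hfN : ‖f‖ * (ε * s) ≤ N / 8 := by
    calc ‖f‖ * (ε * s) ≤ (M * (|f A| + |f B|)) * (ε * s) := by
          gcongr
          exact hfM f
      _ = (M * ε) * N := by rw [hN]; ring
      _ ≤ N / 8 := by nlinarith
  have e1 := abs_le.1 ((abs_map_sub_le (f := f) hP).trans hfN)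
  have e2 := abs_le.1 ((abs_map_sub_le (f := f) hQ).trans hfN)
  simp only [map_sub, map_add, map_smul, smul_eq_mul] at e1 e2 hy
  have hA : s * |f A| ≤ d + N / 8 := by
    rw [← abs_of_pos hs, ← abs_mul]
    exact abs_le.2 ⟨by linarith, by linarith⟩
  have hB : s * |f B| ≤ d + N / 8 := by
    rw [← abs_of_pos hs, ← abs_mul]
    exact abs_le.2 ⟨by linarith, by linarith⟩
  have hNd : N ≤ 8 / 3 * d := by
    have : N = s * |f A| + s * |f B| := by rw [hN]; ring
    linarith
  have hA' : s * f A ≤ -(2 / 3 * d) := by linarith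
  have hB' : s * f B ≤ -(2 / 3 * d) := by linarith
  have hpq : p + q ≤ 2 * s := by
    have h1 : -d ≤ p * f A + q * f B := by linarith
    have h2 : s * (-d) ≤ s * (p * f A + q * f B) := by gcongr
    have h3 : p * (s * f A) ≤ p * (-(2 / 3 * d)) := by gcongr
    have h4 : q * (s * f B) ≤ q * (-(2 / 3 * d)) := by gcongr
    by_contra! h'
    nlinarith
  rw [add_sub_cancel_left]
  refine (norm_add_le _ _).trans ?_
  rw [norm_smul, norm_smul, Real.norm_of_nonneg hp, Real.norm_of_nonneg hq]
  nlinarith [norm_nonneg A, norm_nonneg B]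

lemma gain_ge {ρ : E2 → ℝ} (hρ : IsNorm ρ) {C : ℝ} (hC : ∀ x, ρ x ≤ C * ‖x‖) (hC0 : 0 ≤ C)
    {x₀ A B P Q : E2} {ε s : ℝ} (hs : 0 < s)
    (hP : ‖P - x₀ - s • A‖ ≤ ε * s) (hQ : ‖Q - x₀ - s • B‖ ≤ ε * s) :
    s * (ρ A + ρ B - ρ (B - A) - 4 * C * ε) ≤ ρ (x₀ - P) + ρ (Q - x₀) - ρ (Q - P) := by
  have kP : ρ (P - x₀ - s • A) ≤ C * (ε * s) := (hC _).trans (by gcongr)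
  have kQ : ρ (Q - x₀ - s • B) ≤ C * (ε * s) := (hC _).trans (by gcongr)
  have h1 : ρ (s • A) ≤ ρ (x₀ - P) + ρ (P - x₀ - s • A) := by
    have := hρ.2.2 (P - x₀) (-(P - x₀ - s • A))
    rw [hρ.map_neg, hρ.map_sub_rev P x₀] at this
    convert this using 2
    abel
  have h2 : ρ (s • B) ≤ ρ (Q - x₀) + ρ (Q - x₀ - s • B) := by
    have := hρ.2.2 (Q - x₀) (-(Q - x₀ - s • B))
    rw [hρ.map_neg] at this
    convert this using 2
    abel
  have h3 : ρ (Q - P) ≤ ρ (s • (B - A)) + (ρ (Q - x₀ - s • B) + ρ (P - x₀ - s • A)) := by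
    have e1 := hρ.2.2 (s • (B - A)) ((Q - x₀ - s • B) + -(P - x₀ - s • A))
    have e2 := hρ.2.2 (Q - x₀ - s • B) (-(P - x₀ - s • A))
    rw [hρ.map_neg] at e2
    have e3 : s • (B - A) + ((Q - x₀ - s • B) + -(P - x₀ - s • A)) = Q - P := by module
    rw [e3] at e1
    linarith
  rw [hρ.map_smul_of_nonneg hs.le] at h1 h2 h3
  linarith

/-- Strictness of the triangle inequality for positive combinations of two vectors does not depend
on the coefficients. -/
lemma IsNorm.lt_of_lt {ρ : E2 → ℝ} (hρ : IsNorm ρ) {u v : E2} {a b α β : ℝ} (ha : 0 < a)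
    (hb : 0 < b) (hα : 0 < α) (hβ : 0 < β) (h : ρ (a • u + b • v) < a * ρ u + b * ρ v) :
    ρ (α • u + β • v) < α * ρ u + β * ρ v := by
  set k := min (α / a) (β / b) with hk
  have hk0 : 0 < k := lt_min (by positivity) (by positivity)
  have h1 : 0 ≤ α - k * a := by
    have := min_le_left (α / a) (β / b)
    rw [← hk, le_div_iff₀ ha] at this
    linarith
  have h2 : 0 ≤ β - k * b := by
    have := min_le_right (α / a) (β / b)
    rw [← hk, le_div_iff₀ hb] at this
    linarith
  have e : α • u + β • v =
      k • (a • u + b • v) + ((α - k * a) • u + (β - k * b) • v) := by module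
  have i1 := hρ.2.2 (k • (a • u + b • v)) ((α - k * a) • u + (β - k * b) • v)
  have i2 := hρ.2.2 ((α - k * a) • u) ((β - k * b) • v)
  rw [← e, hρ.map_smul_of_nonneg hk0.le] at i1
  rw [hρ.map_smul_of_nonneg h1, hρ.map_smul_of_nonneg h2] at i2
  nlinarith

lemma eventually_norm_sub_le {γ : ℝ → E2} {t₀ c : ℝ} {x₀ v : E2} {l : Filter ℝ}
    (hc : c ≠ 0) (hexp : (fun t => γ t - x₀ - (t - t₀) • v) =o[l] fun t => t - t₀)
    (hl : Tendsto (fun s => t₀ + c * s) (nhdsWithin (0 : ℝ) (Ioi 0)) l) {ε : ℝ} (hε : 0 < ε) :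
    ∀ᶠ s in nhdsWithin (0 : ℝ) (Ioi 0), ‖γ (t₀ + c * s) - x₀ - s • (c • v)‖ ≤ ε * s := by
  have hc' : 0 < |c| := abs_pos.2 hc
  have h := hl.eventually ((isLittleO_iff.1 hexp) (show 0 < ε / |c| by positivity))
  filter_upwards [h, self_mem_nhdsWithin] with s hs hs0
  have hs0' : 0 < s := hs0
  rw [add_sub_cancel_left, Real.norm_eq_abs, abs_mul, abs_of_pos hs0'] at hs
  have e1 : ε / |c| * (|c| * s) = ε * s := by field_simp
  rw [e1, mul_comm c s, mul_smul, mul_comm s c] at hs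
  exact hs

lemma tendsto_add_mul_nhdsGT (t₀ : ℝ) {c : ℝ} (hc : 0 < c) :
    Tendsto (fun s => t₀ + c * s) (nhdsWithin (0 : ℝ) (Ioi 0)) (nhdsWithin t₀ (Ioi t₀)) := by
  refine tendsto_nhdsWithin_iff.2 ⟨?_, ?_⟩
  · have : Tendsto (fun s => t₀ + c * s) (nhds 0) (nhds (t₀ + c * 0)) :=
      (show Continuous fun s => t₀ + c * s by fun_prop).tendsto 0
    rw [mul_zero, add_zero] at this
    exact this.mono_left nhdsWithin_le_nhds
  · filter_upwards [self_mem_nhdsWithin] with s hs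
    exact mem_Ioi.2 (lt_add_of_pos_right _ (mul_pos hc (mem_Ioi.1 hs)))

lemma tendsto_add_mul_nhdsLT (t₀ : ℝ) {c : ℝ} (hc : c < 0) :
    Tendsto (fun s => t₀ + c * s) (nhdsWithin (0 : ℝ) (Ioi 0)) (nhdsWithin t₀ (Iio t₀)) := by
  refine tendsto_nhdsWithin_iff.2 ⟨?_, ?_⟩
  · have : Tendsto (fun s => t₀ + c * s) (nhds 0) (nhds (t₀ + c * 0)) :=
      (show Continuous fun s => t₀ + c * s by fun_prop).tendsto 0
    rw [mul_zero, add_zero] at this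
    exact this.mono_left nhdsWithin_le_nhds
  · filter_upwards [self_mem_nhdsWithin] with s hs
    exact mem_Iio.2 (add_lt_of_neg_right _ (mul_neg_of_neg_of_pos hc (mem_Ioi.1 hs)))

/-- `V s` is obtained from the convex set `U` by cutting off the corner `x₀` along the chord
joining the boundary points `P s` and `Q s`, which approach `x₀` along the directions `A`, `B`. -/
structure IsCornerCut (U : Set E2) (x₀ A B : E2) (P Q : ℝ → E2) (V : ℝ → Set E2) : Prop where
  isOpen : IsOpen U
  convex : Convex ℝ U
  isBounded : Bornology.IsBounded U
  nonempty : U.Nonempty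
  corner_mem : x₀ ∈ frontier U
  independent : ∀ p q : ℝ, p • A + q • B = 0 → p = 0 ∧ q = 0
  left_mem : ∀ s, P s ∈ frontier U
  right_mem : ∀ s, Q s ∈ frontier U
  left_expansion : ∀ ε > 0, ∀ᶠ s in nhdsWithin (0 : ℝ) (Ioi 0), ‖P s - x₀ - s • A‖ ≤ ε * s
  right_expansion : ∀ ε > 0, ∀ᶠ s in nhdsWithin (0 : ℝ) (Ioi 0), ‖Q s - x₀ - s • B‖ ≤ ε * s
  cut : ∀ᶠ s in nhdsWithin (0 : ℝ) (Ioi 0), IsOpen (V s) ∧ Convex ℝ (V s) ∧ V s ⊆ U ∧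
    ∃ S : Set E2, x₀ ∈ S ∧ frontier (V s) = (frontier U \ S) ∪ segment ℝ (P s) (Q s)

namespace IsCornerCut

variable {U : Set E2} {x₀ A B : E2} {P Q : ℝ → E2} {V : ℝ → Set E2}

lemma eventually_exists_functional (h : IsCornerCut U x₀ A B P Q V) :
    ∀ᶠ s in nhdsWithin (0 : ℝ) (Ioi 0), IsOpen (V s) ∧ Convex ℝ (V s) ∧ (V s).Nonempty ∧
      P s ≠ Q s ∧ segment ℝ (P s) (Q s) ⊆ frontier (V s) ∧
      ∃ f : E2 →L[ℝ] ℝ, f (P s) = f (Q s) ∧ f (P s) < f x₀ ∧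
        V s = {x | x ∈ U ∧ f x < f (P s)} ∧
        ∀ x ∈ U, f x = f (P s) → x ∈ segment ℝ (P s) (Q s) := by
  obtain ⟨M, hM, -, hbound, -⟩ := exists_basis_bounds h.independent
  have hε : 0 < 1 / (8 * M) := by positivity
  filter_upwards [h.left_expansion _ hε, h.right_expansion _ hε, h.cut, self_mem_nhdsWithin]
    with s hP hQ hcut hs
  obtain ⟨hVo, hVc, hVU, S, hxS, hfr⟩ := hcut
  obtain ⟨hne, hseg⟩ := chord_nondegenerate hM hbound hs
    (le_of_eq (by field_simp)) hP hQ
  obtain ⟨hVne, f, hf⟩ := exists_chord_functional h.isOpen h.convex hVo hVc hVU h.corner_mem hxS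
    hseg hfr
  exact ⟨hVo, hVc, hVne, hne, hfr ▸ subset_union_right, f, hf⟩

/-- Truncating a corner decreases the `ρ`-perimeter to first order when the triangle inequality is
strict. -/
lemma eventually_setPerim_le (h : IsCornerCut U x₀ A B P Q V) {ρ : E2 → ℝ} (hρ : IsNorm ρ)
    (hlt : ρ (B - A) < ρ A + ρ B) :
    ∃ c > 0, ∀ᶠ s in nhdsWithin (0 : ℝ) (Ioi 0), setPerim ρ (V s) ≤ setPerim ρ U - c * s := by
  obtain ⟨C, hC0, hC⟩ := hρ.exists_le_mul_norm
  set δ := ρ A + ρ B - ρ (B - A) with hδ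
  have hδ0 : 0 < δ := by linarith
  have hε : 0 < δ / (8 * (C + 1)) := by positivity
  refine ⟨δ / 2, by positivity, ?_⟩
  filter_upwards [h.eventually_exists_functional, h.left_expansion _ hε, h.right_expansion _ hε,
    self_mem_nhdsWithin] with s hs hP hQ hs0
  obtain ⟨hVo, hVc, hVne, hPQ, hfr, f, hf, hfx, hV, hseg⟩ := hs
  have hs0' : 0 < s := hs0
  have h1 := setPerim_add_le_of_chord hρ h.isOpen h.convex h.isBounded hVo hVc hVne hf hfx hV
    hseg hPQ (h.left_mem s) (h.right_mem s) h.corner_mem hfr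
  have h2 := gain_ge hρ hC hC0 hs0' hP hQ
  have h3 : 4 * C * (δ / (8 * (C + 1))) ≤ δ / 2 := by
    rw [mul_div_assoc', div_le_div_iff₀ (by positivity) two_pos]
    nlinarith
  have h4 : s * (δ / 2) ≤ s * (ρ A + ρ B - ρ (B - A) - 4 * C * (δ / (8 * (C + 1)))) := by
    gcongr
    linarith
  linarith

/-- Truncating a corner increases the principal eigenvalue by a quantity of order `s ^ (3 / 2)`. -/
lemma eventually_eigen_le (h : IsCornerCut U x₀ A B P Q V) :
    ∃ C > 0, ∀ᶠ s in nhdsWithin (0 : ℝ) (Ioi 0),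
      eigen (V s) ≤ eigen U + C * s ^ (3 / 2 : ℝ) := by
  have hnot : x₀ ∉ U := by
    have := h.corner_mem
    rw [h.isOpen.frontier_eq] at this
    exact this.2
  obtain ⟨g, hg1, hg, -⟩ := exists_supporting_functional h.isOpen h.convex h.nonempty hnot
  set n : E2 := (InnerProductSpace.toDual ℝ E2).symm (-g) with hn
  have hn1 : ‖n‖ = 1 := by rw [hn, LinearIsometryEquiv.norm_map, norm_neg, hg1]
  have hpos : ∀ x ∈ U, 0 < inner ℝ n (x - x₀) := fun x hx => by
    rw [hn, InnerProductSpace.toDual_symm_apply]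
    simpa using hg x hx
  obtain ⟨C, hC, r₁, hr₁, hr⟩ :=
    exists_eigen_le_add_rpow h.isOpen h.isBounded h.nonempty hn1 hpos
  obtain ⟨M, hM, hspan, -, hfM⟩ := exists_basis_bounds h.independent
  have hε : 0 < 1 / (8 * M) := by positivity
  set K := 2 * (‖A‖ + ‖B‖) + 1 with hK
  have hK0 : 0 < K := by positivity
  have hsmall : ∀ᶠ s in nhdsWithin (0 : ℝ) (Ioi 0), s ∈ Ioo 0 (r₁ / K) :=
    Ioo_mem_nhdsGT (by positivity)
  refine ⟨C * K ^ (3 / 2 : ℝ), by positivity, ?_⟩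
  filter_upwards [h.eventually_exists_functional, h.left_expansion _ hε, h.right_expansion _ hε,
    hsmall] with s hs hP hQ hs0
  obtain ⟨hVo, -, -, -, -, f, hf, hfx, hV, -⟩ := hs
  have hs' : 0 < s := hs0.1
  have hKs : K * s < r₁ := by
    have := hs0.2
    rw [lt_div_iff₀ hK0] at this
    linarith
  have hmain := hr (K * s) (by positivity) hKs (V s) hVo fun x hx hxK => by
    rw [hV]
    refine ⟨hx, ?_⟩
    by_contra! hle
    obtain ⟨p, q, hpq⟩ := hspan (x - x₀)
    have hx' : x = x₀ + (p • A + q • B) := by rw [← hpq, add_sub_cancel]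
    have hcl : x₀ + (p • A + q • B) ∈ closure U := hx' ▸ subset_closure hx
    have hp : 0 ≤ p := nonneg_of_mem_closure_of_corner h.isOpen h.convex h.nonempty h.corner_mem
      h.independent h.left_mem h.right_mem h.left_expansion h.right_expansion hcl
    have hq : 0 ≤ q := nonneg_of_mem_closure_of_corner h.isOpen h.convex h.nonempty h.corner_mem
      (fun u v huv => (h.independent v u (by rw [add_comm, huv])).symm)
      h.right_mem h.left_mem h.right_expansion h.left_expansion
      (p := q) (q := p) (by rwa [add_comm (q • B)])
    rw [hx'] at hle hxK
    have := norm_sub_le_of_cap hfM hs' hε (le_of_eq (by field_simp)) hP hQ hf hfx hp hq hle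
    linarith
  rwa [Real.mul_rpow hK0.le hs'.le, ← mul_assoc] at hmain

end IsCornerCut

lemma isCornerCut_of_arc {U : Set E2} (hUo : IsOpen U) (hUb : Bornology.IsBounded U)
    (hUc : Convex ℝ U) (hUne : U.Nonempty) {γ : ℝ → E2} {t₀ : ℝ} {x₀ vminus vplus : E2}
    (hγx₀ : γ t₀ = x₀) (hrange : frontier U = Set.range γ)
    (hvm : ‖vminus‖ = 1) (hcol : ¬ ∃ c : ℝ, vplus = c • vminus)
    (hexpm : (fun t => γ t - x₀ - (t - t₀) • vminus) =o[nhdsWithin t₀ (Iio t₀)]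
      fun t => t - t₀)
    (hexpp : (fun t => γ t - x₀ - (t - t₀) • vplus) =o[nhdsWithin t₀ (Ioi t₀)]
      fun t => t - t₀)
    {a b : ℝ} (ha : 0 < a) (hb : 0 < b) {V : ℝ → Set E2} {s₀ : ℝ} (hs₀ : 0 < s₀)
    (hV : ∀ s ∈ Ioo (0 : ℝ) s₀,
      IsOpen (V s) ∧ Convex ℝ (V s) ∧ V s ⊆ U ∧
      frontier (V s) =
        (frontier U \ γ '' Ioo (t₀ - a * s) (t₀ + b * s)) ∪
          segment ℝ (γ (t₀ - a * s)) (γ (t₀ + b * s))) :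
    IsCornerCut U x₀ ((-a) • vminus) (b • vplus) (fun s => γ (t₀ + (-a) * s))
      (fun s => γ (t₀ + b * s)) V where
  isOpen := hUo
  convex := hUc
  isBounded := hUb
  nonempty := hUne
  corner_mem := hrange ▸ ⟨t₀, hγx₀⟩
  independent := fun p q hpq => by
    have hvm0 : vminus ≠ 0 := norm_ne_zero_iff.1 (by rw [hvm]; exact one_ne_zero)
    have hq : q = 0 := by
      by_contra hq
      refine hcol ⟨p * a / (q * b), ?_⟩
      have h1 : (q * b) • vplus = (p * a) • vminus := by
        rw [← sub_eq_zero, ← hpq]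
        module
      rw [div_eq_inv_mul, mul_smul, ← h1, smul_smul, inv_mul_cancel₀ (by positivity), one_smul]
    rw [hq, zero_smul, add_zero, smul_smul] at hpq
    have := (smul_eq_zero.1 hpq).resolve_right hvm0
    exact ⟨(mul_eq_zero.1 this).resolve_right (by linarith), hq⟩
  left_mem := fun s => hrange ▸ mem_range_self _
  right_mem := fun s => hrange ▸ mem_range_self _
  left_expansion := fun ε hε =>
    eventually_norm_sub_le (by linarith) hexpm (tendsto_add_mul_nhdsLT t₀ (by linarith)) hε
  right_expansion := fun ε hε =>
    eventually_norm_sub_le hb.ne' hexpp (tendsto_add_mul_nhdsGT t₀ hb) hε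
  cut := by
    filter_upwards [Ioo_mem_nhdsGT hs₀] with s hs
    obtain ⟨h1, h2, h3, h4⟩ := hV s hs
    refine ⟨h1, h2, h3, γ '' Ioo (t₀ - a * s) (t₀ + b * s), ⟨t₀, ⟨?_, ?_⟩, hγx₀⟩, ?_⟩
    · exact sub_lt_self _ (mul_pos ha hs.1)
    · exact lt_add_of_pos_right _ (mul_pos hb hs.1)
    · rw [h4, neg_mul, ← sub_eq_add_neg]

/-- Corners of a minimizer force equality in the triangle inequality for `ρ` along
the one-sided tangent directions; and when the strict triangle inequality holds,
cutting the corner cap `V s` decreases the `ρ`-perimeter by a definite multiple of `s`.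
Here `γ` is a Euclidean arc-length parametrization of `∂U₀` with a corner at
`x₀ = γ t₀` having one-sided tangents `v⁻, v⁺`, and `V s` is obtained from `U₀` by
replacing the boundary arc `γ([t₀ - a s, t₀ + b s])` by the straight chord. -/
theorem stmt19 (ρ : E2 → ℝ) (hρ : IsNorm ρ)
    (U₀ : Set E2) (hU₀o : IsOpen U₀) (hU₀b : Bornology.IsBounded U₀)
    (hU₀c : Convex ℝ U₀) (hU₀ne : U₀.Nonempty)
    (γ : ℝ → E2) (t₀ : ℝ) (x₀ : E2) (vminus vplus : E2)
    (hγx₀ : γ t₀ = x₀) (hrange : frontier U₀ = Set.range γ)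
    (hvm : ‖vminus‖ = 1) (hvp : ‖vplus‖ = 1) (hne : vminus ≠ vplus)
    (hcol : ¬ ∃ c : ℝ, vplus = c • vminus)
    (hexpm : (fun t => γ t - x₀ - (t - t₀) • vminus) =o[nhdsWithin t₀ (Iio t₀)]
      fun t => t - t₀)
    (hexpp : (fun t => γ t - x₀ - (t - t₀) • vplus) =o[nhdsWithin t₀ (Ioi t₀)]
      fun t => t - t₀)
    (a b : ℝ) (ha : 0 < a) (hb : 0 < b)
    (V : ℝ → Set E2) (s₀ : ℝ) (hs₀ : 0 < s₀)
    (hV : ∀ s ∈ Ioo (0 : ℝ) s₀,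
      IsOpen (V s) ∧ Convex ℝ (V s) ∧ V s ⊆ U₀ ∧
      frontier (V s) =
        (frontier U₀ \ γ '' Ioo (t₀ - a * s) (t₀ + b * s)) ∪
          segment ℝ (γ (t₀ - a * s)) (γ (t₀ + b * s))) :
    ((∀ s ∈ Ioo (0 : ℝ) s₀, Ffun ρ U₀ ≤ Ffun ρ (V s)) →
      ρ (a • vplus + b • vminus) = a * ρ vplus + b * ρ vminus) ∧
    (ρ (a • vplus + b • vminus) < a * ρ vplus + b * ρ vminus →
      ∃ c : ℝ, 0 < c ∧ ∃ s₁ : ℝ, 0 < s₁ ∧ ∀ s ∈ Ioo (0 : ℝ) s₁,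
        setPerim ρ (V s) ≤ setPerim ρ U₀ - c * s) := by
  have hcut := isCornerCut_of_arc hU₀o hU₀b hU₀c hU₀ne hγx₀ hrange hvm hcol hexpm hexpp ha hb
    hs₀ hV
  have hperim : ρ (a • vplus + b • vminus) < a * ρ vplus + b * ρ vminus →
      ∃ c > 0, ∀ᶠ s in nhdsWithin (0 : ℝ) (Ioi 0),
        setPerim ρ (V s) ≤ setPerim ρ U₀ - c * s := fun hlt => by
    refine hcut.eventually_setPerim_le hρ ?_
    have h1 := hρ.lt_of_lt ha hb hb ha hlt
    rw [neg_smul, sub_neg_eq_add, hρ.map_neg, hρ.map_smul_of_nonneg ha.le,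
      hρ.map_smul_of_nonneg hb.le]
    linarith
  refine ⟨fun hF => ?_, fun hlt => ?_⟩
  · refine le_antisymm ?_ ?_
    · have := hρ.2.2 (a • vplus) (b • vminus)
      rwa [hρ.map_smul_of_nonneg ha.le, hρ.map_smul_of_nonneg hb.le] at this
    · by_contra! hlt
      obtain ⟨c, hc, hev⟩ := hperim hlt
      obtain ⟨C, hC, hev'⟩ := hcut.eventually_eigen_le
      have hsmall : ∀ᶠ s in nhdsWithin (0 : ℝ) (Ioi 0), s ∈ Ioo 0 (min s₀ ((c / C) ^ 2)) :=
        Ioo_mem_nhdsGT (lt_min hs₀ (by positivity))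
      obtain ⟨s, h1, h2, h3⟩ := (hev.and (hev'.and hsmall)).exists
      have hs : 0 < s := h3.1
      have h4 := hF s ⟨hs, h3.2.trans_le (min_le_left _ _)⟩
      have h5 : s < (c / C) ^ 2 := h3.2.trans_le (min_le_right _ _)
      have h6 : √s < c / C := (Real.sqrt_lt' (by positivity)).2 h5
      have h7 : s ^ (3 / 2 : ℝ) = s * √s := by
        rw [Real.sqrt_eq_rpow, show (3 / 2 : ℝ) = 1 + 1 / 2 by norm_num, Real.rpow_add hs,
          Real.rpow_one]
      rw [lt_div_iff₀ hC] at h6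
      simp only [Ffun] at h4
      rw [h7] at h2
      have h8 : s * (√s * C) < s * c := by gcongr
      linarith
  · obtain ⟨c, hc, hev⟩ := hperim hlt
    obtain ⟨s₁, hs₁, hsub⟩ := mem_nhdsGT_iff_exists_Ioo_subset.1 hev
    exact ⟨c, hc, s₁, hs₁, fun s hs => hsub hs⟩
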